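/- arXiv:cs/0509023 — 3 statements merged into one kernel-verified Lean document; each statement's English description precedes it below -/
import Mathlib

section
/- For any finite simple graph G and any vertex v of G, either G contains a Meyniel obstruction, or G contains a strong stable set containing v, or both. -/
open SimpleGraph

/-- The set of chords of a closed walk `c` in `G`: edges of `G` joining two
vertices of `c` that are not edges of `c` (i.e. not consecutive on `c`). -/
def SimpleGraph.cycleChords {V : Type*} (G : SimpleGraph V) {u : V} (c : G.Walk u u) :
    Set (Sym2 V) :=
  {e | e ∈ G.edgeSet ∧ (∀ x ∈ e, x ∈ c.support) ∧ e ∉ c.edges}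

/-- A Meyniel obstruction in `G` is an odd cycle of length at least five with
at most one chord. -/
def SimpleGraph.HasMeynielObstruction {V : Type*} (G : SimpleGraph V) : Prop :=
  ∃ (u : V) (c : G.Walk u u), c.IsCycle ∧ Odd c.length ∧ 5 ≤ c.length ∧
    (G.cycleChords c).ncard ≤ 1

/-- A stable (independent) set: a set of pairwise nonadjacent vertices. -/
def SimpleGraph.IsStableSet {V : Type*} (G : SimpleGraph V) (S : Set V) : Prop :=
  S.Pairwise fun a b => ¬ G.Adj a b

/-- A strong stable set: a stable set meeting every inclusion-maximal clique. -/
def SimpleGraph.IsStrongStableSet {V : Type*} (G : SimpleGraph V) (S : Set V) : Prop :=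
  G.IsStableSet S ∧
    ∀ Q : Set V, G.IsClique Q → (∀ Q' : Set V, G.IsClique Q' → Q ⊆ Q' → Q' = Q) →
      (S ∩ Q).Nonempty

namespace Mey

variable {V : Type*}

def IPath (H : SimpleGraph V) (p : ℕ → V) (n : ℕ) : Prop :=
  ∀ a b, a < b → b ≤ n → p a ≠ p b ∧ (H.Adj (p a) (p b) ↔ b = a + 1)

def Hole (H : SimpleGraph V) (r : V) (p : ℕ → V) (n : ℕ) : Prop :=
  IPath H p n ∧ ∀ a, a ≤ n → r ≠ p a ∧ (H.Adj r (p a) ↔ (a = 0 ∨ a = n))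

def Flag (H : SimpleGraph V) (r : V) (p : ℕ → V) (n m : ℕ) (z : V) : Prop :=
  Hole H r p n ∧ m < n ∧ z ≠ r ∧ ¬ H.Adj z r ∧
    ∀ a, a ≤ n → z ≠ p a ∧ (H.Adj z (p a) ↔ (a = m ∨ a = m + 1))

def QM (H : SimpleGraph V) (w : V) : Prop :=
  (∀ r p n, Odd n → 3 ≤ n → ¬ Hole H r p n) ∧
  (∀ r p n m z, Even n → 2 ≤ n → Flag H r p n m z → w = p m ∨ w = p (m + 1))

theorem IPath.sub {H : SimpleGraph V} {p : ℕ → V} {n : ℕ} (h : IPath H p n) (i k : ℕ)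
    (hk : i + k ≤ n) : IPath H (fun x => p (i + x)) k := by
  intro a b hab hb
  have := h (i + a) (i + b) (by omega) (by omega)
  refine ⟨this.1, this.2.trans ?_⟩
  omega

theorem IPath.rev {H : SimpleGraph V} {p : ℕ → V} {n : ℕ} (h : IPath H p n) :
    IPath H (fun x => p (n - x)) n := by
  intro a b hab hb
  have := h (n - b) (n - a) (by omega) (by omega)
  refine ⟨this.1.symm, (H.adj_comm _ _).trans (this.2.trans ?_)⟩
  omega

theorem Hole.rev {H : SimpleGraph V} {r : V} {p : ℕ → V} {n : ℕ} (h : Hole H r p n) :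
    Hole H r (fun x => p (n - x)) n := by
  refine ⟨h.1.rev, fun a ha => ?_⟩
  have := h.2 (n - a) (by omega)
  refine ⟨this.1, this.2.trans ?_⟩
  omega

theorem Flag.rev {H : SimpleGraph V} {r : V} {p : ℕ → V} {n m : ℕ} {z : V}
    (h : Flag H r p n m z) : Flag H r (fun x => p (n - x)) n (n - m - 1) z := by
  obtain ⟨h1, h2, h3, h4, h5⟩ := h
  refine ⟨h1.rev, by omega, h3, h4, fun a ha => ?_⟩
  have := h5 (n - a) (by omega)
  refine ⟨this.1, this.2.trans ?_⟩
  omega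

/-- rotate by one -/
theorem Hole.rot {H : SimpleGraph V} {r : V} {p : ℕ → V} {n : ℕ} (h : Hole H r p n)
    (hn : 2 ≤ n) : Hole H (p 0) (fun x => if x < n then p (x + 1) else r) n := by
  obtain ⟨h1, h2⟩ := h
  refine ⟨fun a b hab hb => ?_, fun a ha => ?_⟩
  · by_cases hbn : b < n
    · have := h1 (a + 1) (b + 1) (by omega) (by omega)
      simp only [hbn, show a < n by omega, if_true]
      refine ⟨this.1, this.2.trans ?_⟩
      omega
    · have := h2 (a + 1) (by omega)
      simp only [hbn, show a < n by omega, if_true, if_false]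
      refine ⟨this.1.symm, (H.adj_comm _ _).trans (this.2.trans ?_)⟩
      omega
  · by_cases han : a < n
    · have := h1 0 (a + 1) (by omega) (by omega)
      simp only [han, if_true]
      refine ⟨this.1, this.2.trans ?_⟩
      omega
    · have := h2 0 (by omega)
      simp only [han, if_false]
      refine ⟨this.1.symm, (H.adj_comm _ _).trans (this.2.trans ?_)⟩
      omega

theorem Flag.rot {H : SimpleGraph V} {r : V} {p : ℕ → V} {n m : ℕ} {z : V}
    (h : Flag H r p n m z) (hn : 2 ≤ n) (hm : 0 < m) :
    Flag H (p 0) (fun x => if x < n then p (x + 1) else r) n (m - 1) z := by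
  obtain ⟨h1, h2, h3, h4, h5⟩ := h
  have h0 := h5 0 (by omega)
  refine ⟨h1.rot hn, by omega, h0.1, ?_, fun a ha => ?_⟩
  · rw [h0.2]; omega
  · by_cases han : a < n
    · have := h5 (a + 1) (by omega)
      simp only [han, if_true]
      refine ⟨this.1, this.2.trans ?_⟩
      omega
    · simp only [han, if_false]
      refine ⟨h3, ?_⟩
      constructor
      · intro h; exact absurd h h4
      · intro h; omega

theorem Hole.reroot {H : SimpleGraph V} {n : ℕ} (hn : 2 ≤ n) (t : ℕ) :
    ∀ (r : V) (p : ℕ → V), Hole H r p n → t ≤ n → ∃ q, Hole H (p t) q n := by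
  induction t with
  | zero => intro r p h _; exact ⟨_, h.rot hn⟩
  | succ t ih =>
    intro r p h ht
    have := ih _ _ (h.rot hn) (by omega)
    simpa [show t < n by omega] using this

theorem Flag.reroot {H : SimpleGraph V} {n : ℕ} (hn : 2 ≤ n) (t : ℕ) :
    ∀ (r : V) (p : ℕ → V) (m : ℕ) (z : V), Flag H r p n m z → t < m →
      ∃ q m', Flag H (p t) q n m' z ∧ q m' = p m ∧ q (m' + 1) = p (m + 1) := by
  induction t with
  | zero =>
    intro r p m z h ht
    have hm := h.2.1
    refine ⟨_, _, h.rot hn ht, ?_, ?_⟩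
    · simp [show m - 1 < n by omega, show m - 1 + 1 = m by omega]
    · simp [show m - 1 + 1 = m by omega, hm]
  | succ t ih =>
    intro r p m z h ht
    have hm := h.2.1
    obtain ⟨q, m', h1, h2, h3⟩ := ih _ _ _ _ (h.rot hn (by omega)) (show t < m - 1 by omega)
    refine ⟨q, m', ?_, ?_, ?_⟩
    · simpa [show t < n by omega] using h1
    · simpa [show m - 1 < n by omega, show m - 1 + 1 = m by omega] using h2
    · simpa [show m - 1 + 1 = m by omega, hm] using h3

/-- flag edge contains the root `d`. -/
theorem QM.noflag {H : SimpleGraph V} {w : V} (hQ : QM H w) {q : ℕ → V} {n : ℕ}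
    (hp : IPath H q n) {d : V} (hn : 3 ≤ n) (hodd : Odd n)
    (hd : ∀ a ≤ n, d ≠ q a ∧ (H.Adj d (q a) ↔ (a = 0 ∨ a = 1 ∨ a = n)))
    (hdw : d ≠ w) (hw : q 1 ≠ w) : False := by
  have hF : Flag H (q n) (fun x => if x = 0 then d else q x) (n - 1) 0 (q 0) := by
    refine ⟨⟨fun a b hab hb => ?_, fun a ha => ?_⟩, by omega, ?_, ?_, fun a ha => ?_⟩
    · by_cases ha0 : a = 0
      · have := hd b (by omega)
        simp only [ha0, if_true, show b ≠ 0 by omega, if_false]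
        refine ⟨this.1, this.2.trans ?_⟩
        omega
      · have := hp a b (by omega) (by omega)
        simp only [ha0, show b ≠ 0 by omega, if_false]
        exact this
    · by_cases ha0 : a = 0
      · have := hd n (by omega)
        simp only [ha0, if_true]
        refine ⟨this.1.symm, (H.adj_comm _ _).trans (this.2.trans ?_)⟩
        grind
      · have := hp a n (by omega) (by omega)
        simp only [ha0, if_false]
        refine ⟨this.1.symm, (H.adj_comm _ _).trans (this.2.trans ?_)⟩
        grind
    · exact (hp 0 n (by omega) (by omega)).1
    · rw [(hp 0 n (by omega) (by omega)).2]; omega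
    · by_cases ha0 : a = 0
      · have := hd 0 (by omega)
        simp only [ha0, if_true]
        refine ⟨this.1.symm, (H.adj_comm _ _).trans (this.2.trans ?_)⟩
        grind
      · have := hp 0 a (by omega) (by omega)
        simp only [ha0, if_false]
        refine ⟨this.1, this.2.trans ?_⟩
        grind
  have he : Even (n - 1) := by
    obtain ⟨k, hk⟩ := hodd
    exact ⟨k, by omega⟩
  rcases hQ.2 _ _ _ _ _ he (by omega) hF with h | h
  · simp at h; exact hdw h.symm
  · simp at h; exact hw h.symm

theorem comb {D : ℕ → Prop} {N : ℕ}
    (h1 : ∀ i n, i + n ≤ N → Odd n → 3 ≤ n → D i → D (i + n) →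
      ∃ a, 0 < a ∧ a < n ∧ D (i + a))
    (h2 : ∀ i n, i + n ≤ N → Odd n → 3 ≤ n → D i → D (i + 1) → D (i + n) →
      ∃ a, 1 < a ∧ a < n ∧ D (i + a))
    (h3 : ∀ i n, i + n ≤ N → Odd n → 3 ≤ n → D i → D (i + n - 1) → D (i + n) →
      ∃ a, 0 < a ∧ a < n - 1 ∧ D (i + a)) :
    ∀ n i, i + n ≤ N → Odd n → D i → D (i + n) → ∀ a ≤ n, D (i + a) := by
  intro n
  induction n using Nat.strong_induction_on with
  | _ n ih =>
  intro i hi hodd hD0 hDn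
  -- interval version
  have ih' : ∀ x y, i ≤ x → x ≤ y → y ≤ i + n → y - x < n → Odd (y - x) → D x → D y →
      ∀ a, x ≤ a → a ≤ y → D a := by
    intro x y hx hxy hy hlt ho hDx hDy a ha hay
    have := ih (y - x) hlt x (by omega) ho hDx (by rwa [show x + (y - x) = y by omega])
      (a - x) (by omega)
    rwa [show x + (a - x) = a by omega] at this
  have key : ∀ a, 1 < a → a < n - 1 → D (i + a) → ∀ a ≤ n, D (i + a) := by
    intro m hm1 hm2 hDm a ha
    obtain ⟨k, hk⟩ := hodd
    rcases Nat.even_or_odd m with ⟨l, hl⟩ | ⟨l, hl⟩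
    · have r1 := ih' (i + m) (i + n) (by omega) (by omega) (by omega) (by omega)
        ⟨k - l, by omega⟩ hDm hDn
      have r2 := ih' i (i + m + 1) (by omega) (by omega) (by omega) (by omega)
        ⟨l, by omega⟩ hD0 (r1 _ (by omega) (by omega))
      by_cases h : a ≤ m
      · exact r2 _ (by omega) (by omega)
      · exact r1 _ (by omega) (by omega)
    · have r1 := ih' i (i + m) (by omega) (by omega) (by omega) (by omega)
        ⟨l, by omega⟩ hD0 hDm
      have r2 := ih' (i + m - 1) (i + n) (by omega) (by omega) (by omega) (by omega)
        ⟨k - l, by omega⟩ (r1 _ (by omega) (by omega)) hDn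
      by_cases h : a ≤ m
      · exact r1 _ (by omega) (by omega)
      · exact r2 _ (by omega) (by omega)
  by_cases hn : n < 3
  · obtain ⟨k, hk⟩ := hodd
    have : n = 1 := by omega
    subst this
    intro a ha
    interval_cases a
    · exact hD0
    · exact hDn
  obtain ⟨m, hm0, hmn, hDm⟩ := h1 i n hi hodd (by omega) hD0 hDn
  have fin : D (i + 1) → D (i + n - 1) → ∀ a ≤ n, D (i + a) := by
    intro hA hB a ha
    rcases Nat.eq_zero_or_pos a with h | h
    · subst h; exact hD0
    rcases eq_or_ne a n with h' | h'
    · subst h'; exact hDn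
    obtain ⟨k, hk⟩ := hodd
    exact ih' (i + 1) (i + n - 1) (by omega) (by omega) (by omega) (by omega)
        ⟨k - 1, by omega⟩ hA hB _ (by omega) (by omega)
  rcases eq_or_ne m 1 with rfl | hne1
  · obtain ⟨m', hm0', hmn', hDm'⟩ := h2 i n hi hodd (by omega) hD0 hDm hDn
    rcases eq_or_ne m' (n - 1) with rfl | hne
    · exact fin hDm (by rwa [show i + n - 1 = i + (n - 1) by omega])
    · exact key m' hm0' (by omega) hDm'
  rcases eq_or_ne m (n - 1) with rfl | hne
  · have hB : D (i + n - 1) := by rwa [show i + n - 1 = i + (n - 1) by omega]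
    obtain ⟨m', hm0', hmn', hDm'⟩ := h3 i n hi hodd (by omega) hD0 hB hDn
    rcases eq_or_ne m' 1 with rfl | hne
    · exact fin hDm' hB
    · exact key m' (by omega) (by omega) hDm'
  · exact key m (by omega) (by omega) hDm

theorem QM.lemA {H : SimpleGraph V} {w : V} (hQ : QM H w) {q : ℕ → V} {N : ℕ}
    (hp : IPath H q N) {d : V} (hdw : d ≠ w) (hd : ∀ a ≤ N, d ≠ q a)
    (hw : ∀ a, 0 < a → a < N → q a ≠ w) :
    ∀ n i, i + n ≤ N → Odd n → H.Adj d (q i) → H.Adj d (q (i + n)) →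
      ∀ a ≤ n, H.Adj d (q (i + a)) := by
  apply comb (D := fun x => H.Adj d (q x))
  · intro i n hi ho hn h0 h1
    by_contra! hc
    refine hQ.1 d _ n ho hn ⟨hp.sub i n hi, fun a ha => ⟨hd _ (by omega), ?_⟩⟩
    constructor
    · intro h
      by_contra! h'
      exact hc a (by omega) (by omega) h
    · rintro (rfl | rfl)
      · exact h0
      · exact h1
  · intro i n hi ho hn h0 h1 h2
    by_contra! hc
    refine hQ.noflag (hp.sub i n hi) (d := d) hn ho
      (fun a ha => ⟨hd _ (by omega), ?_⟩) hdw (hw _ (by omega) (by omega))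
    constructor
    · intro h
      by_contra! h'
      exact hc a (by omega) (by omega) h
    · rintro (rfl | rfl | rfl)
      · exact h0
      · exact h1
      · exact h2
  · intro i n hi ho hn h0 h1 h2
    by_contra! hc
    refine hQ.noflag (hp.sub i n hi).rev (d := d) hn ho
      (fun a ha => ⟨hd _ (by omega), ?_⟩) hdw (hw _ (by omega) (by omega))
    constructor
    · intro h
      by_contra! h'
      exact hc (n - a) (by omega) (by omega) h
    · rintro (rfl | rfl | rfl)
      · exact h2
      · simpa [show i + (n - 1) = i + n - 1 by omega] using h1
      · simpa using h0

theorem IPath.dne {H : SimpleGraph V} {q : ℕ → V} {N : ℕ} (hp : IPath H q N) (hN : 3 ≤ N)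
    {d : V} (h0 : H.Adj d (q 0)) (h1 : H.Adj d (q N)) : ∀ a ≤ N, d ≠ q a := by
  rintro a ha rfl
  have ha0 : a ≠ 0 := by rintro rfl; exact H.irrefl h0
  have ha1 : a ≠ N := by rintro rfl; exact H.irrefl h1
  have e0 := (hp 0 a (by omega) (by omega)).2.1 h0.symm
  have e1 := (hp a N (by omega) (by omega)).2.1 h1
  omega

/-- odd path from w -/
theorem QM.core1 {H : SimpleGraph V} {q : ℕ → V} (hQ : QM H (q 0)) {N : ℕ}
    (hp : IPath H q N) (hN : 3 ≤ N) (ho : Odd N) {d : V} (h0 : H.Adj d (q 0))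
    (h1 : H.Adj d (q N)) : ∀ a ≤ N, H.Adj d (q a) := by
  intro a ha
  have := hQ.lemA hp h0.ne (hp.dne hN h0 h1)
    (fun a h0 h1 => (hp 0 a h0 h1.le).1.symm) N 0 (by omega) ho h0 (by simpa using h1) a ha
  simpa using this

theorem QM.core2 {H : SimpleGraph V} {q : ℕ → V} (hQ : QM H (q 0)) {N : ℕ}
    (hp : IPath H q N) (hN : 4 ≤ N) (he : Even N) {d : V} (h0 : H.Adj d (q 0))
    (h1 : H.Adj d (q N)) (h2 : ¬ H.Adj d (q 2)) {j : ℕ} (hj1 : 1 ≤ j) (hjN : j + 2 ≤ N)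
    {z : V} (hz : ∀ a ≤ N, z ≠ q a ∧ (H.Adj z (q a) ↔ (a = j ∨ a = j + 1))) : False := by
  have hdne := hp.dne (by omega) h0 h1
  have lem := hQ.lemA hp h0.ne hdne (fun a h0 h1 => (hp 0 a h0 h1.le).1.symm)
  have lem0 : ∀ n ≤ N, 2 ≤ n → Odd n → ¬ H.Adj d (q n) := by
    intro n hn h2n ho h
    have := lem n 0 (by omega) ho h0 (by simpa using h) 2 h2n
    exact h2 (by simpa using this)
  have hdz : d ≠ z := by
    rintro rfl
    have := (hz 0 (by omega)).2.1 h0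
    omega
  obtain ⟨K, hK⟩ := he
  by_cases hadj : H.Adj d z
  · rcases Nat.even_or_odd j with ⟨l, hl⟩ | ⟨l, hl⟩
    · have hP : IPath H (fun x => if x ≤ j then q x else z) (j + 1) := by
        intro a b hab hb
        by_cases hbj : b ≤ j
        · simp only [hbj, show a ≤ j by omega, if_true]
          exact hp a b hab (by omega)
        · simp only [hbj, show a ≤ j by omega, if_true, if_false]
          have := hz a (by omega)
          refine ⟨this.1.symm, (H.adj_comm _ _).trans (this.2.trans ?_)⟩
          omega
      have hQ' : QM H ((fun x => if x ≤ j then q x else z) 0) := by simpa using hQ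
      have := QM.core1 (q := fun x => if x ≤ j then q x else z) hQ' hP (by omega) ⟨l, by omega⟩ (d := d) (by simpa using h0)
        (by simpa using hadj) 2 (by omega)
      simp only [show 2 ≤ j by omega, if_true] at this
      exact h2 this
    · have hP : IPath H (fun x => if x = 0 then z else q (j + x)) (N - j) := by
        intro a b hab hb
        by_cases ha : a = 0
        · simp only [ha, if_true, show b ≠ 0 by omega, if_false]
          have := hz (j + b) (by omega)
          refine ⟨this.1, this.2.trans ?_⟩
          omega
        · simp only [ha, show b ≠ 0 by omega, if_false]
          have := hp (j + a) (j + b) (by omega) (by omega)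
          refine ⟨this.1, this.2.trans ?_⟩
          omega
      have hdd : H.Adj d (q (j + (N - j))) := by rwa [show j + (N - j) = N by omega]
      have := hQ.lemA hP h0.ne (d := d) ?_ ?_ (N - j) 0 (by omega) ⟨K - l - 1, by omega⟩
        (by simpa using hadj)
        (by simpa [show N - j ≠ 0 by omega] using hdd) (N - j - 1) (by omega)
      · simp only [show 0 + (N - j - 1) ≠ 0 by omega, if_false,
          show j + (0 + (N - j - 1)) = N - 1 by omega] at this
        exact lem0 (N - 1) (by omega) (by omega) ⟨K - 1, by omega⟩ this
      · intro a ha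
        by_cases ha0 : a = 0
        · simpa [ha0] using hdz
        · simp only [ha0, if_false]
          exact hdne _ (by omega)
      · intro a ha ha'
        simp only [show a ≠ 0 by omega, if_false]
        exact (hp 0 (j + a) (by omega) (by omega)).1.symm
  · -- l = last neighbour ≤ j, r = first neighbour ≥ j+1
    classical
    obtain ⟨l, ⟨hlj, hDl⟩, hlmax⟩ : ∃ l, (l ≤ j ∧ H.Adj d (q l)) ∧
        ∀ x, l < x → x ≤ j → ¬ H.Adj d (q x) := by
      refine ⟨Nat.findGreatest (fun x => H.Adj d (q x)) j,
        ⟨Nat.findGreatest_le _, Nat.findGreatest_spec (P := fun x => H.Adj d (q x))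
          (Nat.zero_le j) h0⟩, fun x hx hxj => Nat.findGreatest_is_greatest hx hxj⟩
    have hex : ∃ r, j + 1 ≤ r ∧ H.Adj d (q r) := ⟨N, by omega, h1⟩
    obtain ⟨r, ⟨hjr, hDr⟩, hrmin⟩ : ∃ r, (j + 1 ≤ r ∧ H.Adj d (q r)) ∧
        ∀ x, j + 1 ≤ x → x < r → ¬ H.Adj d (q x) :=
      ⟨Nat.find hex, Nat.find_spec hex, fun x hx hxr h => Nat.find_min hex hxr ⟨hx, h⟩⟩
    have hrN : r ≤ N := by
      by_contra hc
      exact hrmin N (by omega) (by omega) h1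
    have hH : Hole H d (fun x => q (l + x)) (r - l) := by
      refine ⟨hp.sub l (r - l) (by omega), fun a ha => ⟨hdne _ (by omega), ?_, ?_⟩⟩
      · intro h
        by_contra! hc
        by_cases hx : l + a ≤ j
        · exact hlmax (l + a) (by omega) hx h
        · exact hrmin (l + a) (by omega) (by omega) h
      · rintro (rfl | rfl)
        · exact hDl
        · show H.Adj d (q (l + (r - l)))
          rwa [show l + (r - l) = r by omega]
    rcases Nat.even_or_odd (r - l) with hev | hod
    · have hF : Flag H d (fun x => q (l + x)) (r - l) (j - l) z := by
        refine ⟨hH, by omega, hdz.symm, fun h => hadj h.symm, fun a ha => ?_⟩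
        have := hz (l + a) (by omega)
        refine ⟨this.1, this.2.trans ?_⟩
        omega
      obtain ⟨k, hk⟩ := hev
      rcases hQ.2 _ _ _ _ _ ⟨k, hk⟩ (by omega) hF with h | h
      · exact (hp 0 (l + (j - l)) (by omega) (by omega)).1 h
      · exact (hp 0 (l + (j - l + 1)) (by omega) (by omega)).1 h
    · by_cases h3 : 3 ≤ r - l
      · exact hQ.1 _ _ _ hod h3 hH
      · obtain ⟨k, hk⟩ := hod
        have e1 : l = j := by omega
        have e2 : r = j + 1 := by omega
        subst e1 e2
        rcases Nat.even_or_odd l with ⟨m, hm⟩ | ⟨m, hm⟩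
        · exact lem0 (l + 1) (by omega) (by omega) ⟨m, by omega⟩ hDr
        · by_cases hl : l = 1
          · subst hl; exact h2 hDr
          · exact lem0 l (by omega) (by omega) ⟨m, hm⟩ hDl

/-- contraction of `s` into `w` -/
def contr (H : SimpleGraph V) (w s : V) (hws : ¬ H.Adj w s) : SimpleGraph V where
  Adj x y := x ≠ s ∧ y ≠ s ∧ (H.Adj x y ∨ (x = w ∧ H.Adj s y) ∨ (y = w ∧ H.Adj s x))
  symm := ⟨by
    rintro x y ⟨h1, h2, h3⟩
    refine ⟨h2, h1, ?_⟩
    rcases h3 with h | h | h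
    · exact Or.inl h.symm
    · exact Or.inr (Or.inr h)
    · exact Or.inr (Or.inl h)⟩
  loopless := ⟨by
    rintro x ⟨h1, h2, h3⟩
    rcases h3 with h | ⟨rfl, h⟩ | ⟨rfl, h⟩
    · exact H.irrefl h
    · exact hws h.symm
    · exact hws h.symm⟩

def MaxP (H : SimpleGraph V) (w s : V) : Prop :=
  ∀ u a, u ≠ w → ¬ H.Adj w u → H.Adj u a → H.Adj w a → ¬ H.Adj s a →
    ∃ d, H.Adj w d ∧ H.Adj s d ∧ ¬ H.Adj u d

section
variable {H : SimpleGraph V} {w s : V} {hws : ¬ H.Adj w s}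

theorem contr_adj {x y : V} (hx : x ≠ s) (hy : y ≠ s) (hxw : x ≠ w) (hyw : y ≠ w) :
    (contr H w s hws).Adj x y ↔ H.Adj x y := by
  simp [contr, hx, hy, hxw, hyw]

theorem contr_adj_w {y : V} (hsw : w ≠ s) (hy : y ≠ s) (hyw : y ≠ w) :
    (contr H w s hws).Adj w y ↔ (H.Adj w y ∨ H.Adj s y) := by
  simp [contr, hsw, hy, hyw]

theorem contr_ne {x y : V} (h : (contr H w s hws).Adj x y) : x ≠ s := h.1

/-- extended path `w, p 0, …, p n, s` -/
theorem ext_path {p : ℕ → V} {n : ℕ} (hsw : w ≠ s) (hws' : ¬ H.Adj w s) (hp : IPath H p n)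
    (hw : ∀ a ≤ n, w ≠ p a ∧ (H.Adj w (p a) ↔ a = 0))
    (hs : ∀ a ≤ n, s ≠ p a ∧ (H.Adj s (p a) ↔ a = n)) :
    IPath H (fun x => if x = 0 then w else if x ≤ n + 1 then p (x - 1) else s) (n + 2) := by
  intro a b hab hb
  have hb0 : b ≠ 0 := by omega
  by_cases ha : a = 0
  · by_cases hbn : b ≤ n + 1
    · have := hw (b - 1) (by omega)
      simp only [ha, hb0, hbn, if_true, if_false]
      refine ⟨this.1, this.2.trans ?_⟩
      omega
    · simp only [ha, hb0, hbn, if_true, if_false]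
      refine ⟨hsw, fun h => absurd h hws', fun h => by omega⟩
  · by_cases hbn : b ≤ n + 1
    · have := hp (a - 1) (b - 1) (by omega) (by omega)
      simp only [ha, hb0, hbn, show a ≤ n + 1 by omega, if_true, if_false]
      refine ⟨this.1, this.2.trans ?_⟩
      omega
    · have := hs (a - 1) (by omega)
      simp only [ha, hb0, hbn, show a ≤ n + 1 by omega, if_true, if_false]
      refine ⟨this.1.symm, (H.adj_comm _ _).trans (this.2.trans ?_)⟩
      omega

theorem p4free (hQ : QM H w) (hM : MaxP H w s) (hsw : w ≠ s) (hws' : ¬ H.Adj w s) {a b : V}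
    (hwa : H.Adj w a) (hab : H.Adj a b) (hbs : H.Adj s b) (hwb : ¬ H.Adj w b)
    (hsa : ¬ H.Adj s a) : False := by
  have hbw : b ≠ w := by rintro rfl; exact hws' hbs.symm
  obtain ⟨d, hd1, hd2, hd3⟩ := hM b a hbw hwb hab.symm hwa hsa
  have hp : IPath H (fun x => if x = 0 then a else b) 1 := by
    intro x y hxy hy
    have hx : x = 0 := by omega
    have hy : y = 1 := by omega
    subst hx hy
    simp [hab, hab.ne]
  have hP := ext_path hsw hws' hp ?_ ?_
  · have := QM.core1 (by simpa using hQ) hP (by omega) (by decide) (d := d)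
      (by simpa using hd1.symm) (by simpa using hd2.symm) 2 (by omega)
    simp at this
    exact hd3 this.symm
  · intro x hx
    interval_cases x
    · simp [hwa, hwa.ne]
    · simp [hwb, hbw.symm]
  · intro x hx
    interval_cases x
    · simp [hsa]; rintro rfl; exact hws' hwa
    · simp [hbs, hbs.ne]

theorem hole_ne (hH : ∀ {x y}, (contr H w s hws).Adj x y → x ≠ s) {r : V} {p : ℕ → V} {n : ℕ}
    (hn : 2 ≤ n) (h : Hole (contr H w s hws) r p n) : r ≠ s ∧ ∀ a ≤ n, p a ≠ s := by
  refine ⟨hH ((h.2 0 (by omega)).2.2 (Or.inl rfl)), fun a ha => ?_⟩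
  by_cases han : a = n
  · subst han
    exact hH ((h.2 a ha).2.2 (Or.inr rfl)).symm
  · exact hH ((h.1 a (a + 1) (by omega) (by omega)).2.2 rfl)

/-- if `w` is not on the path, it is a path of `H` -/
theorem path_H {p : ℕ → V} {n : ℕ} (h : IPath (contr H w s hws) p n)
    (hs : ∀ a ≤ n, p a ≠ s) (hw : ∀ a ≤ n, p a ≠ w) : IPath H p n := by
  intro a b hab hb
  have := h a b hab hb
  rwa [contr_adj (hs _ (by omega)) (hs _ hb) (hw _ (by omega)) (hw _ hb)] at this

/-- Analysis of a hole rooted at `w`. -/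
theorem hole_w (hsw : w ≠ s) {p : ℕ → V} {n : ℕ} (hn : 2 ≤ n)
    (h : Hole (contr H w s hws) w p n) :
    IPath H p n ∧ (∀ a ≤ n, w ≠ p a ∧ s ≠ p a) ∧
    (∀ a ≤ n, (H.Adj w (p a) ∨ H.Adj s (p a)) ↔ (a = 0 ∨ a = n)) := by
  have hne := (hole_ne contr_ne hn h).2
  have hw : ∀ a ≤ n, p a ≠ w := fun a ha => (h.2 a ha).1.symm
  refine ⟨path_H h.1 hne hw, fun a ha => ⟨(hw a ha).symm, (hne a ha).symm⟩, fun a ha => ?_⟩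
  rw [← (h.2 a ha).2, contr_adj_w hsw (hne a ha) (hw a ha)]

theorem hole_cases (hsw : w ≠ s) {p : ℕ → V} {n : ℕ} (hn : 2 ≤ n)
    (h : Hole (contr H w s hws) w p n) :
    Hole H w p n ∨ Hole H s p n ∨
      (H.Adj w (p 0) ∧ ¬ H.Adj s (p 0) ∧ H.Adj s (p n) ∧ ¬ H.Adj w (p n)) ∨
      (H.Adj w (p n) ∧ ¬ H.Adj s (p n) ∧ H.Adj s (p 0) ∧ ¬ H.Adj w (p 0)) := by
  obtain ⟨h1, h2, h3⟩ := hole_w hsw hn h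
  by_cases hw : H.Adj w (p 0) ∧ H.Adj w (p n)
  · left
    refine ⟨h1, fun a ha => ⟨(h2 a ha).1, fun h => (h3 a ha).1 (Or.inl h), ?_⟩⟩
    rintro (rfl | rfl)
    exacts [hw.1, hw.2]
  by_cases hs : H.Adj s (p 0) ∧ H.Adj s (p n)
  · right; left
    refine ⟨h1, fun a ha => ⟨(h2 a ha).2, fun h => (h3 a ha).1 (Or.inr h), ?_⟩⟩
    rintro (rfl | rfl)
    exacts [hs.1, hs.2]
  have a0 := (h3 0 (by omega)).2 (Or.inl rfl)
  have an := (h3 n (by omega)).2 (Or.inr rfl)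
  tauto

/-- mixed case: path and `d` -/
theorem mixed (hsw : w ≠ s) (hM : MaxP H w s) {p : ℕ → V} {n : ℕ} (hn : 2 ≤ n)
    (h : Hole (contr H w s hws) w p n)
    (hm : H.Adj w (p 0) ∧ ¬ H.Adj s (p 0) ∧ H.Adj s (p n) ∧ ¬ H.Adj w (p n)) :
    IPath H (fun x => if x = 0 then w else if x ≤ n + 1 then p (x - 1) else s) (n + 2) ∧
    ∃ d, H.Adj w d ∧ H.Adj s d ∧ ¬ H.Adj d (p 1) := by
  obtain ⟨h1, h2, h3⟩ := hole_w hsw hn h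
  obtain ⟨m1, m2, m3, m4⟩ := hm
  constructor
  · refine ext_path hsw hws h1 (fun a ha => ⟨(h2 a ha).1, ?_, ?_⟩)
      (fun a ha => ⟨(h2 a ha).2, ?_, ?_⟩)
    · intro h'
      rcases (h3 a ha).1 (Or.inl h') with rfl | rfl
      · rfl
      · exact absurd h' m4
    · rintro rfl; exact m1
    · intro h'
      rcases (h3 a ha).1 (Or.inr h') with rfl | rfl
      · exact absurd h' m2
      · rfl
    · rintro rfl; exact m3
  · have hw1 : ¬ H.Adj w (p 1) := by
      intro h
      have := (h3 1 (by omega)).1 (Or.inl h)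
      omega
    obtain ⟨d, hd1, hd2, hd3⟩ := hM (p 1) (p 0) (h2 1 (by omega)).1.symm hw1
      ((h1 0 1 (by omega) (by omega)).2.2 rfl).symm m1 m2
    exact ⟨d, hd1, hd2, fun h => hd3 h.symm⟩

theorem no_hole_w (hQ : QM H w) (hsw : w ≠ s) (hM : MaxP H w s) {p : ℕ → V} {n : ℕ}
    (hn : 3 ≤ n) (ho : Odd n) (h : Hole (contr H w s hws) w p n) : False := by
  have aux : ∀ p : ℕ → V, Hole (contr H w s hws) w p n →
      (H.Adj w (p 0) ∧ ¬ H.Adj s (p 0) ∧ H.Adj s (p n) ∧ ¬ H.Adj w (p n)) → False := by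
    intro p h hm
    obtain ⟨hP, d, hd1, hd2, hd3⟩ := mixed hsw hM (by omega) h hm
    obtain ⟨k, hk⟩ := ho
    have := QM.core1 (by simpa using hQ) hP (by omega) ⟨k + 1, by omega⟩ (d := d)
      (by simpa using hd1.symm) (by simpa using hd2.symm) 2 (by omega)
    simp [show 1 ≤ n by omega] at this
    exact hd3 this
  rcases hole_cases hsw (by omega) h with h' | h' | h' | h'
  · exact hQ.1 _ _ _ ho hn h'
  · exact hQ.1 _ _ _ ho hn h'
  · exact aux p h h'
  · exact aux _ h.rev (by simpa using h')

theorem no_flag_w (hQ : QM H w) (hsw : w ≠ s) (hM : MaxP H w s) {p : ℕ → V} {n m : ℕ} {z : V}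
    (hn : 2 ≤ n) (he : Even n) (h : Flag (contr H w s hws) w p n m z) : False := by
  have facts : ∀ (p : ℕ → V) (m : ℕ), Flag (contr H w s hws) w p n m z →
      ¬ H.Adj z w ∧ ¬ H.Adj z s ∧ z ≠ s ∧
      ∀ a, a ≤ n → z ≠ p a ∧ (H.Adj z (p a) ↔ (a = m ∨ a = m + 1)) := by
    intro p m h
    obtain ⟨h1, h2, h3, h4, h5⟩ := h
    have hne := (hole_ne contr_ne hn h1).2
    have hzs : z ≠ s := contr_ne ((h5 m (by omega)).2.2 (Or.inl rfl))
    have h4' : ¬ (contr H w s hws).Adj w z := fun h => h4 h.symm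
    rw [contr_adj_w hsw hzs h3] at h4'
    push Not at h4'
    refine ⟨fun h => h4'.1 h.symm, fun h => h4'.2 h.symm, hzs, fun a ha => ?_⟩
    have := h5 a ha
    rwa [contr_adj hzs (hne a ha) h3 (h1.2 a ha).1.symm] at this
  have aux : ∀ (p : ℕ → V) (m : ℕ), Flag (contr H w s hws) w p n m z →
      (H.Adj w (p 0) ∧ ¬ H.Adj s (p 0) ∧ H.Adj s (p n) ∧ ¬ H.Adj w (p n)) → False := by
    intro p m h hm
    obtain ⟨f1, f2, f3, f4⟩ := facts p m h
    obtain ⟨hP, d, hd1, hd2, hd3⟩ := mixed hsw hM (by omega) h.1 hm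
    obtain ⟨k, hk⟩ := he
    have hmn := h.2.1
    refine QM.core2 (by simpa using hQ) hP (by omega) ⟨k + 1, by omega⟩ (d := d) (z := z)
      (by simpa using hd1.symm) (by simpa using hd2.symm)
      (by simpa [show 1 ≤ n by omega] using hd3) (j := m + 1) (by omega) (by omega) ?_
    intro a ha
    by_cases ha0 : a = 0
    · simp only [ha0, if_true]
      exact ⟨h.2.2.1, fun h => absurd h f1, fun h => by omega⟩
    · by_cases han : a ≤ n + 1
      · simp only [ha0, han, if_true, if_false]
        have := f4 (a - 1) (by omega)
        refine ⟨this.1, this.2.trans ?_⟩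
        omega
      · simp only [ha0, han, if_false]
        exact ⟨f3, fun h => absurd h f2, fun h => by omega⟩
  obtain ⟨f1, f2, f3, f4⟩ := facts p m h
  have hmn := h.2.1
  have hwp : ∀ a ≤ n, w ≠ p a := fun a ha => (h.1.2 a ha).1
  rcases hole_cases hsw (by omega) h.1 with h' | h' | h' | h'
  · rcases hQ.2 _ _ _ _ _ he hn ⟨h', h.2.1, h.2.2.1, f1, f4⟩ with e | e
    · exact hwp _ (by omega) e
    · exact hwp _ (by omega) e
  · rcases hQ.2 _ _ _ _ _ he hn ⟨h', h.2.1, f3, f2, f4⟩ with e | e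
    · exact hwp _ (by omega) e
    · exact hwp _ (by omega) e
  · exact aux p m h h'
  · exact aux _ _ h.rev (by simpa using h')

theorem hole_H {r : V} {p : ℕ → V} {n : ℕ} (hn : 2 ≤ n) (h : Hole (contr H w s hws) r p n)
    (hr : r ≠ w) (hw : ∀ a ≤ n, p a ≠ w) : Hole H r p n := by
  obtain ⟨h1, h2⟩ := hole_ne contr_ne hn h
  refine ⟨path_H h.1 h2 hw, fun a ha => ?_⟩
  have := h.2 a ha
  rwa [contr_adj h1 (h2 a ha) hr (hw a ha)] at this

theorem QM.contr (hQ : QM H w) (hsw : w ≠ s) (hM : MaxP H w s) : QM (contr H w s hws) w := by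
  constructor
  · intro r p n ho hn h
    by_cases hr : r = w
    · subst hr; exact no_hole_w hQ hsw hM hn ho h
    by_cases hp : ∃ a ≤ n, p a = w
    · obtain ⟨a, ha, rfl⟩ := hp
      obtain ⟨q, hq⟩ := Hole.reroot (by omega) a r p h ha
      exact no_hole_w hQ hsw hM hn ho hq
    · push Not at hp
      exact hQ.1 _ _ _ ho hn (hole_H (by omega) h hr hp)
  · intro r p n m z he hn h
    by_contra! hc
    have hmn := h.2.1
    by_cases hr : r = w
    · subst hr; exact no_flag_w hQ hsw hM hn he h
    by_cases hp : ∃ a ≤ n, p a = w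
    · obtain ⟨a, ha, rfl⟩ := hp
      by_cases ham : a < m
      · obtain ⟨q, m', hq, -, -⟩ := Flag.reroot hn a r p m z h ham
        exact no_flag_w hQ hsw hM hn he hq
      · have h1 : a ≠ m := by rintro rfl; exact hc.1 rfl
        have h2 : a ≠ m + 1 := by rintro rfl; exact hc.2 rfl
        obtain ⟨q, m', hq, -, -⟩ := Flag.reroot hn (n - a) r _ _ z h.rev (by omega)
        simp only [show n - (n - a) = a by omega] at hq
        exact no_flag_w hQ hsw hM hn he hq
    push Not at hp
    obtain ⟨g1, g2⟩ := hole_ne contr_ne hn h.1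
    have hH := hole_H hn h.1 hr hp
    obtain ⟨h1, h2, h3, h4, h5⟩ := h
    have hzs : z ≠ s := contr_ne ((h5 m (by omega)).2.2 (Or.inl rfl))
    by_cases hz : z = w
    · subst hz
      have h5' : ∀ a ≤ n, (H.Adj z (p a) ∨ H.Adj s (p a)) ↔ (a = m ∨ a = m + 1) := by
        intro a ha
        rw [← (h5 a ha).2, contr_adj_w hsw (g2 a ha) (hp a ha)]
      rw [contr_adj_w hsw g1 hr] at h4
      push Not at h4
      have b0 := (h5' m (by omega)).2 (Or.inl rfl)
      have b1 := (h5' (m + 1) (by omega)).2 (Or.inr rfl)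
      have hadj : H.Adj (p m) (p (m + 1)) := (hH.1 m (m + 1) (by omega) (by omega)).2.2 rfl
      by_cases cw : H.Adj z (p m) ∧ H.Adj z (p (m + 1))
      · have : Flag H r p n m z := by
          refine ⟨hH, hmn, h3, h4.1, fun a ha => ⟨(h5 a ha).1,
            fun h => (h5' a ha).1 (Or.inl h), ?_⟩⟩
          rintro (rfl | rfl)
          exacts [cw.1, cw.2]
        rcases hQ.2 _ _ _ _ _ he hn this with e | e
        · exact hc.1 e
        · exact hc.2 e
      by_cases cs : H.Adj s (p m) ∧ H.Adj s (p (m + 1))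
      · have : Flag H r p n m s := by
          refine ⟨hH, hmn, g1.symm, h4.2, fun a ha => ⟨(g2 a ha).symm,
            fun h => (h5' a ha).1 (Or.inr h), ?_⟩⟩
          rintro (rfl | rfl)
          exacts [cs.1, cs.2]
        rcases hQ.2 _ _ _ _ _ he hn this with e | e
        · exact hc.1 e
        · exact hc.2 e
      by_cases c : H.Adj z (p m)
      · exact p4free hQ hM hsw hws c hadj (by tauto) (by tauto) (by tauto)
      · exact p4free hQ hM hsw hws (a := p (m + 1)) (b := p m) (by tauto) hadj.symm
          (by tauto) (by tauto) (by tauto)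
    · have : Flag H r p n m z := by
        refine ⟨hH, hmn, h3, ?_, fun a ha => ?_⟩
        · rwa [contr_adj hzs g1 hz hr] at h4
        · have := h5 a ha
          rwa [contr_adj hzs (g2 a ha) hz (hp a ha)] at this
      rcases hQ.2 _ _ _ _ _ he hn this with e | e
      · exact hc.1 e
      · exact hc.2 e

end

theorem insert_clique {H : SimpleGraph V} {Q : Set V} (hQ : H.IsClique Q)
    (hmax : ∀ Q' : Set V, H.IsClique Q' → Q ⊆ Q' → Q' = Q) {x : V} (hx : x ∉ Q) :
    ∃ y ∈ Q, ¬ H.Adj x y := by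
  by_contra! hc
  have : H.IsClique (insert x Q) := hQ.insert (fun b hb _ => hc b hb)
  have := hmax _ this (Set.subset_insert _ _)
  exact hx (this ▸ Set.mem_insert _ _)

theorem step [Finite V] {H : SimpleGraph V} {w s : V} (hws : ¬ H.Adj w s) (hQM : QM H w)
    (hsw : w ≠ s) (hM : MaxP H w s) {S : Set V} (hS : (contr H w s hws).IsStrongStableSet S)
    (hwS : w ∈ S) : H.IsStrongStableSet (insert s S) := by
  obtain ⟨h1, h2⟩ := hS
  have hs : ∀ y ∈ S, ¬ H.Adj s y := by
    intro y hy h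
    have hyw : y ≠ w := by rintro rfl; exact hws h.symm
    exact h1 hwS hy hyw.symm ⟨hsw, h.ne', Or.inr (Or.inl ⟨rfl, h⟩)⟩
  constructor
  · intro x hx y hy hxy
    rcases hx with rfl | hx
    · rcases hy with rfl | hy
      · exact absurd rfl hxy
      · exact hs y hy
    · rcases hy with rfl | hy
      · exact fun h => hs x hx h.symm
      · intro h
        by_cases hxs : x = s
        · subst hxs; exact hs y hy h
        by_cases hys : y = s
        · subst hys; exact hs x hx h.symm
        exact h1 hx hy hxy ⟨hxs, hys, Or.inl h⟩
  · intro Q hQ hmax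
    by_contra hne
    have hdis : ∀ x ∈ Q, x ≠ s ∧ x ∉ S := by
      intro x hx
      constructor
      · rintro rfl; exact hne ⟨x, Or.inl rfl, hx⟩
      · intro h; exact hne ⟨x, Or.inr h, hx⟩
    have hwQ : w ∉ Q := fun h => (hdis w h).2 hwS
    have hsQ : s ∉ Q := fun h => (hdis s h).1 rfl
    have hQ' : (contr H w s hws).IsClique Q := by
      intro x hx y hy hxy
      exact ⟨(hdis x hx).1, (hdis y hy).1, Or.inl (hQ hx hy hxy)⟩
    obtain ⟨R, hQR, hR⟩ := Finite.exists_le_maximal (p := (contr H w s hws).IsClique) hQ'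
    obtain ⟨y, hyS, hyR⟩ := h2 R hR.prop (fun Q' hc hsub => (hR.eq_of_subset hc hsub).symm)
    have hyadj : ∀ q ∈ Q, (contr H w s hws).Adj y q := by
      intro q hq
      apply hR.prop hyR (hQR hq)
      rintro rfl
      exact (hdis _ hq).2 hyS
    by_cases hyw : y = w
    · subst hyw
      have hor : ∀ q ∈ Q, H.Adj y q ∨ H.Adj s q := by
        intro q hq
        have := hyadj q hq
        rwa [contr_adj_w hsw (hdis q hq).1 this.ne'] at this
      obtain ⟨b, hb, hyb⟩ := insert_clique hQ hmax hwQ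
      obtain ⟨a, ha, hsa⟩ := insert_clique hQ hmax hsQ
      have hb' := (hor b hb).resolve_left hyb
      have ha' := (hor a ha).resolve_right hsa
      have hab : a ≠ b := by rintro rfl; exact hsa hb'
      exact p4free hQM hM hsw hws ha' (hQ ha hb hab) hb' hyb hsa
    · have hyQ : y ∉ Q := fun h => (hdis y h).2 hyS
      obtain ⟨q, hq, hn⟩ := insert_clique hQ hmax hyQ
      have := hyadj q hq
      rw [contr_adj this.1 (hdis q hq).1 hyw (by rintro rfl; exact hwQ hq)] at this
      exact hn this

theorem exists_strong [Finite V] (w : V) : ∀ (n : ℕ) (H : SimpleGraph V), QM H w →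
    {x | x ≠ w ∧ ∃ y, H.Adj x y}.ncard = n → ∃ S, H.IsStrongStableSet S ∧ w ∈ S := by
  intro n
  induction n using Nat.strong_induction_on with
  | _ n ih =>
  intro H hQ hn
  by_cases hex : ∃ x, x ≠ w ∧ ¬ H.Adj w x ∧ ∃ y, H.Adj x y
  · obtain ⟨s, ⟨hsw, hws, hsy⟩, hmax⟩ := Set.exists_max_image
      {x | x ≠ w ∧ ¬ H.Adj w x ∧ ∃ y, H.Adj x y}
      (fun x => {a | H.Adj w a ∧ H.Adj x a}.ncard) (Set.toFinite _) hex
    have hM : MaxP H w s := by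
      intro u a hu hwu hua hwa hsa
      by_contra! hc
      have := hmax u ⟨hu, hwu, a, hua⟩
      refine absurd this (not_le.2 (Set.ncard_lt_ncard ?_ (Set.toFinite _)))
      refine ⟨fun x hx => ⟨hx.1, hc x hx.1 hx.2⟩, fun h => ?_⟩
      exact hsa (h ⟨hwa, hua⟩).2
    obtain ⟨S, hS, hwS⟩ := ih ({x | x ≠ w ∧ ∃ y, (contr H w s hws).Adj x y}.ncard) (by
      rw [← hn]
      refine Set.ncard_lt_ncard ?_ (Set.toFinite _)
      refine ⟨?_, fun h => ?_⟩
      · rintro x ⟨hx, y, -, -, h⟩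
        refine ⟨hx, ?_⟩
        rcases h with h | h | h
        · exact ⟨y, h⟩
        · exact absurd h.1 hx
        · exact ⟨s, h.2.symm⟩
      · obtain ⟨-, y, h⟩ := h ⟨hsw, hsy⟩
        exact h.1 rfl) (contr H w s hws) (hQ.contr hsw.symm hM) rfl
    exact ⟨_, step hws hQ hsw.symm hM hS hwS, Or.inr hwS⟩
  · push Not at hex
    refine ⟨{x | x = w ∨ ∀ y, ¬ H.Adj x y}, ⟨?_, ?_⟩, Or.inl rfl⟩
    · intro x hx y hy hxy h
      rcases hx with rfl | hx
      · rcases hy with rfl | hy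
        · exact hxy rfl
        · exact hy _ h.symm
      · exact hx _ h
    · intro Q hQc hmax
      by_cases hwQ : w ∈ Q
      · exact ⟨w, Or.inl rfl, hwQ⟩
      · obtain ⟨y, hy, hwy⟩ := insert_clique hQc hmax hwQ
        exact ⟨y, Or.inr (hex y (by rintro rfl; exact hwQ hy) hwy), hy⟩

/-- the walk along a function -/
theorem walk_of (G : SimpleGraph V) (c : ℕ → V) (N : ℕ)
    (h : ∀ k < N, G.Adj (c k) (c (k + 1))) :
    ∃ p : G.Walk (c 0) (c N), p.length = N ∧ p.support = (List.range (N + 1)).map c ∧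
      ∀ k < N, s(c k, c (k + 1)) ∈ p.edges := by
  induction N with
  | zero => exact ⟨.nil, by simp⟩
  | succ N ih =>
    obtain ⟨p, h1, h2, h3⟩ := ih (fun k hk => h k (by omega))
    refine ⟨p.concat (h N (by omega)), by simp [h1], ?_, ?_⟩
    · rw [SimpleGraph.Walk.support_concat, h2, List.range_succ (n := N + 1)]
      simp
    · intro k hk
      rw [SimpleGraph.Walk.edges_concat]
      by_cases hkN : k = N
      · subst hkN; simp
      · simp [h3 k (by omega)]

theorem obstr (G : SimpleGraph V) (r : V) (c : ℕ → V) (N : ℕ) (hN : 3 ≤ N) (ho : Odd N)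
    (e0 : Sym2 V)
    (hadj : ∀ k < N, G.Adj (c k) (c (k + 1)))
    (hinj : ∀ a b, a < b → b ≤ N → c a ≠ c b ∧ (G.Adj (c a) (c b) → b = a + 1 ∨ s(c a, c b) = e0))
    (hr : ∀ a ≤ N, r ≠ c a ∧ (G.Adj r (c a) ↔ (a = 0 ∨ a = N))) :
    G.HasMeynielObstruction := by
  obtain ⟨p, h1, h2, h3⟩ := walk_of G c N hadj
  have a0 : G.Adj r (c 0) := (hr 0 (by omega)).2.2 (Or.inl rfl)
  have aN : G.Adj (c N) r := ((hr N (by omega)).2.2 (Or.inr rfl)).symm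
  have hrs : r ∉ p.support := by
    rw [h2]
    simp only [List.mem_map, List.mem_range, not_exists, not_and]
    intro a ha h
    exact (hr a (by omega)).1 h.symm
  have hpath : p.IsPath := by
    rw [SimpleGraph.Walk.isPath_def, h2]
    refine List.Nodup.map_on ?_ List.nodup_range
    intro a ha b hb hab
    simp only [List.mem_range] at ha hb
    rcases lt_trichotomy a b with h | h | h
    · exact absurd hab (hinj a b h (by omega)).1
    · exact h
    · exact absurd hab.symm (hinj b a h (by omega)).1
  obtain ⟨k, hk⟩ := ho
  refine ⟨r, .cons a0 (p.concat aN), ?_, ⟨k + 1, by simp [h1]; omega⟩, by simp [h1]; omega, ?_⟩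
  · rw [SimpleGraph.Walk.cons_isCycle_iff]
    refine ⟨hpath.concat hrs aN, ?_⟩
    rw [SimpleGraph.Walk.edges_concat]
    simp only [List.concat_eq_append, List.mem_append, List.mem_singleton, not_or]
    refine ⟨fun h => hrs (p.fst_mem_support_of_mem_edges h), ?_⟩
    have := (hinj 0 N (by omega) le_rfl).1
    have := (hr N le_rfl).1
    simp only [Sym2.eq_iff]
    tauto
  · have hsub : G.cycleChords (.cons a0 (p.concat aN)) ⊆ {e0} := by
      rintro e ⟨he1, he2, he3⟩
      induction e using Sym2.ind with
      | _ x y =>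
      simp only [SimpleGraph.Walk.edges_cons, SimpleGraph.Walk.edges_concat,
        List.concat_eq_append, List.mem_cons, List.mem_append, List.not_mem_nil, or_false,
        not_or] at he3
      obtain ⟨n1, n2, n3⟩ := he3
      have hsupp : ∀ x, x ∈ (SimpleGraph.Walk.cons a0 (p.concat aN)).support →
          x = r ∨ ∃ a ≤ N, x = c a := by
        intro x hx
        rw [SimpleGraph.Walk.support_cons, SimpleGraph.Walk.support_concat, h2] at hx
        simp only [List.mem_cons, List.mem_append, List.mem_map,
          List.mem_range, List.not_mem_nil, or_false] at hx
        rcases hx with h | ⟨a, ha, h⟩ | h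
        · exact Or.inl h
        · exact Or.inr ⟨a, by omega, h.symm⟩
        · exact Or.inl h
      rw [SimpleGraph.mem_edgeSet] at he1
      have hroot : ∀ a ≤ N, G.Adj r (c a) → s(r, c a) ≠ s(r, c 0) → s(r, c a) ≠ s(c N, r) →
          False := by
        intro a ha h m1 m2
        rcases (hr a ha).2.1 h with rfl | rfl
        · exact m1 rfl
        · exact m2 Sym2.eq_swap
      have hin : ∀ a b, a < b → b ≤ N → G.Adj (c a) (c b) → s(c a, c b) ∉ p.edges →
          s(c a, c b) = e0 := by
        intro a b hab hb h m1
        rcases (hinj a b hab hb).2 h with rfl | h'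
        · exact absurd (h3 a (by omega)) m1
        · exact h'
      rcases hsupp x (he2 x (Sym2.mem_mk_left _ _)) with rfl | ⟨a, ha, rfl⟩
      · rcases hsupp y (he2 y (Sym2.mem_mk_right _ _)) with rfl | ⟨b, hb, rfl⟩
        · exact absurd he1 (G.irrefl)
        · exact (hroot b hb he1 n1 n3).elim
      · rcases hsupp y (he2 y (Sym2.mem_mk_right _ _)) with rfl | ⟨b, hb, rfl⟩
        · rw [Sym2.eq_swap] at n1 n3
          exact (hroot a ha he1.symm n1 n3).elim
        · rcases lt_trichotomy a b with h | h | h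
          · exact hin a b h hb he1 n2
          · subst h; exact absurd he1 (G.irrefl)
          · rw [Sym2.eq_swap] at n2
            have := hin b a h ha he1.symm n2
            rw [Set.mem_singleton_iff, Sym2.eq_swap]
            exact this
    calc _ ≤ ({e0} : Set (Sym2 V)).ncard := Set.ncard_le_ncard hsub (Set.finite_singleton _)
      _ = 1 := Set.ncard_singleton _

theorem QM_of (G : SimpleGraph V) (hG : ¬ G.HasMeynielObstruction) (w : V) : QM G w := by
  constructor
  · intro r p n ho hn h
    refine hG (obstr G r p n hn ho s(r, r) (fun k hk => ?_) (fun a b hab hb => ?_) h.2)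
    · exact (h.1 k (k + 1) (by omega) (by omega)).2.2 rfl
    · exact ⟨(h.1 a b hab hb).1, fun h' => Or.inl ((h.1 a b hab hb).2.1 h')⟩
  · intro r p n m z he hn h
    exfalso
    obtain ⟨⟨h0, h1⟩, h2, h3, h4, h5⟩ := h
    obtain ⟨k, hk⟩ := he
    refine hG (obstr G r (fun x => if x ≤ m then p x else if x = m + 1 then z else p (x - 1))
      (n + 1) (by omega) ⟨k, by omega⟩ s(p m, p (m + 1)) (fun k hk => ?_)
      (fun a b hab hb => ?_) (fun a ha => ?_))
    · by_cases c1 : k < m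
      · simp only [show k ≤ m by omega, show k + 1 ≤ m by omega, if_true]
        exact (h0 k (k + 1) (by omega) (by omega)).2.2 rfl
      by_cases c2 : k = m
      · subst c2
        simp only [le_rfl, if_true, show ¬ (k + 1 ≤ k) by omega, if_false]
        exact ((h5 k (by omega)).2.2 (Or.inl rfl)).symm
      by_cases c3 : k = m + 1
      · subst c3
        simp only [show ¬ (m + 1 ≤ m) by omega, show ¬ (m + 1 + 1 ≤ m) by omega,
          show ¬ (m + 1 + 1 = m + 1) by omega, if_true, if_false]
        exact (h5 (m + 1) (by omega)).2.2 (Or.inr rfl)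
      · simp only [show ¬ (k ≤ m) by omega, show ¬ (k + 1 ≤ m) by omega,
          show ¬ (k + 1 = m + 1) by omega, c3, if_false]
        exact (h0 (k - 1) (k + 1 - 1) (by omega) (by omega)).2.2 (by omega)
    · by_cases a1 : a ≤ m
      · by_cases b1 : b ≤ m
        · simp only [a1, b1, if_true]
          have := h0 a b hab (by omega)
          exact ⟨this.1, fun h => Or.inl (this.2.1 h)⟩
        by_cases b2 : b = m + 1
        · simp only [a1, b2, if_true, show ¬ (m + 1 ≤ m) by omega, if_false]
          have := h5 a (by omega)
          refine ⟨this.1.symm, fun h => Or.inl ?_⟩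
          have := this.2.1 h.symm
          omega
        · simp only [a1, b1, b2, if_true, if_false]
          have := h0 a (b - 1) (by omega) (by omega)
          refine ⟨this.1, fun h => Or.inr ?_⟩
          have := this.2.1 h
          rw [show a = m by omega, show b - 1 = m + 1 by omega]
      by_cases a2 : a = m + 1
      · subst a2
        simp only [a1, if_true, if_false, show ¬ (b ≤ m) by omega, show ¬ (b = m + 1) by omega]
        have := h5 (b - 1) (by omega)
        refine ⟨this.1, fun h => Or.inl ?_⟩
        have := this.2.1 h
        omega
      · simp only [a1, a2, if_false, show ¬ (b ≤ m) by omega, show ¬ (b = m + 1) by omega]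
        have := h0 (a - 1) (b - 1) (by omega) (by omega)
        refine ⟨this.1, fun h => Or.inl ?_⟩
        have := this.2.1 h
        omega
    · by_cases a1 : a ≤ m
      · simp only [a1, if_true]
        have := h1 a (by omega)
        refine ⟨this.1, this.2.trans ?_⟩
        omega
      by_cases a2 : a = m + 1
      · simp only [a2, if_true, show ¬ (m + 1 ≤ m) by omega, if_false]
        exact ⟨h3.symm, fun h => absurd h.symm h4, fun h => by omega⟩
      · simp only [a1, a2, if_false]
        have := h1 (a - 1) (by omega)
        refine ⟨this.1, this.2.trans ?_⟩
        omega

end Mey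

/-- For any graph `G` and any vertex `v`, either `G` contains a Meyniel
obstruction, or `G` contains a strong stable set containing `v` (or both). -/
theorem hasMeynielObstruction_or_exists_strongStableSet_mem {V : Type*} [Fintype V]
    (G : SimpleGraph V) (v : V) :
    G.HasMeynielObstruction ∨ ∃ S : Set V, G.IsStrongStableSet S ∧ v ∈ S := by
  by_cases hG : G.HasMeynielObstruction
  · exact Or.inl hG
  · exact Or.inr (Mey.exists_strong v _ G (Mey.QM_of G hG v) rfl)
end

section
/- For any finite simple graph G and any vertex v of G, either G contains a Meyniel obstruction, or G contains a nice stable set containing v, or both. -/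
open SimpleGraph

/-- A nice stable set: a maximal stable set `S` together with a linear ordering
`x 0, …, x (k-1)` of its elements such that for each `i` there are no vertices
`a, b` with `ab` an edge, `a` adjacent to some earlier `x j` but not to `x i`,
and `b` adjacent to `x i` but to no earlier `x j`. -/
def SimpleGraph.IsNiceStableSet {V : Type*} (G : SimpleGraph V) (S : Set V) : Prop :=
  G.IsStableSet S ∧ (∀ T : Set V, G.IsStableSet T → S ⊆ T → T = S) ∧
    ∃ (k : ℕ) (x : Fin k → V), Function.Injective x ∧ Set.range x = S ∧
      ∀ i : Fin k, ¬ ∃ a b : V, G.Adj a b ∧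
        (∃ j, j < i ∧ G.Adj a (x j)) ∧ ¬ G.Adj a (x i) ∧
        G.Adj b (x i) ∧ (∀ j, j < i → ¬ G.Adj b (x j))


namespace Mey

/-- obstruction given as a function; `w` occurs at most at position 0 and then has no chord -/
def Obs {U : Type*} (H : SimpleGraph U) (w : U) : Prop :=
  ∃ (m : ℕ) (c : ℕ → U) (s t : ℕ), Odd m ∧ 5 ≤ m ∧
    (∀ i j, i < j → j < m → c i ≠ c j) ∧
    (∀ i, 0 < i → i < m → c i ≠ w) ∧ (c 0 = w → 1 ≤ s) ∧
    (∀ i j, i < j → j < m →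
      (H.Adj (c i) (c j) ↔ (j = i + 1 ∨ (i = 0 ∧ j + 1 = m) ∨ (i = s ∧ j = t))))

/-- path with at most one chord `(s,t)` -/
def Pth {U : Type*} (H : SimpleGraph U) (w : U) (r : ℕ → U) (N s t : ℕ) : Prop :=
  (∀ i j, i < j → j ≤ N → r i ≠ r j) ∧ (∀ i, 0 < i → i ≤ N → r i ≠ w) ∧
  (∀ i j, i < j → j ≤ N → (H.Adj (r i) (r j) ↔ (j = i + 1 ∨ (i = s ∧ j = t))))

/-- `d` sees `r i` and `r j`, outside vertex -/
def Out {U : Type*} (w : U) (r : ℕ → U) (N : ℕ) (d : U) : Prop :=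
  d ≠ w ∧ ∀ i, i ≤ N → r i ≠ d

section
variable {U : Type*} {H : SimpleGraph U} {w : U} {r : ℕ → U} {N s t : ℕ} {d : U}

/-- generic cycle -/
lemma mk (hP : Pth H w r N s t) (hd : Out w r N d) {i j : ℕ} (hij : i + 3 ≤ j) (hj : j ≤ N)
    (hodd : Odd (j - i)) (s' t' : ℕ) (h1 : i = 0 → 1 ≤ s')
    (hc : ∀ a b, a < b → b ≤ j - i → ((i + a = s ∧ i + b = t) ↔ (a = s' ∧ b = t')))
    (hD : ∀ a, a ≤ j - i → (H.Adj d (r (i + a)) ↔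
      (a = 0 ∨ a = j - i ∨ (a = s' ∧ j - i + 1 = t')))) :
    Obs H w := by
  obtain ⟨p1, p2, p3⟩ := hP
  obtain ⟨d1, d2⟩ := hd
  refine ⟨j - i + 2, fun k => if k ≤ j - i then r (i + k) else d, s', t', ?_, by omega, ?_, ?_, ?_, ?_⟩
  · have := hodd; rw [Nat.odd_iff] at *; omega
  · intro a b hab hb
    by_cases hb' : b ≤ j - i
    · have : a ≤ j - i := by omega
      simp only [hb', this, if_true]
      exact p1 _ _ (by omega) (by omega)
    · have : a ≤ j - i := by omega
      simp only [hb', this, if_true, if_false]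
      exact d2 _ (by omega)
  · intro a ha ham
    by_cases hb' : a ≤ j - i
    · simp only [hb', if_true]
      exact p2 _ (by omega) (by omega)
    · simp only [hb', if_false]
      exact d1
  · intro h
    simp only [Nat.zero_le, if_true] at h
    apply h1
    by_contra hi
    exact p2 _ (by omega) (by omega) h
  · intro a b hab hb
    by_cases hb' : b ≤ j - i
    · have ha : a ≤ j - i := by omega
      simp only [hb', ha, if_true]
      rw [p3 _ _ (by omega) (by omega), hc a b hab hb']
      constructor
      · rintro (h | h)
        · left; omega
        · right; right; exact h
      · rintro (h | h | h)
        · left; omega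
        · omega
        · right; exact h
    · have ha : a ≤ j - i := by omega
      simp only [hb', ha, if_true, if_false]
      rw [H.adj_comm, hD a ha]
      have : b = j - i + 1 := by omega
      subst this
      constructor
      · rintro (h | h | h)
        · right; left; omega
        · left; omega
        · right; right; omega
      · rintro (h | h | h)
        · right; left; omega
        · left; omega
        · right; right; omega

lemma k0in (hP : Pth H w r N s t) (hd : Out w r N d) {i j : ℕ} (hij : i + 3 ≤ j) (hj : j ≤ N)
    (hodd : Odd (j - i)) (hs : 1 ≤ s) (hst : s < t) (his : i ≤ s) (htj : t ≤ j)
    (hi : H.Adj d (r i)) (hjd : H.Adj d (r j))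
    (hD : ∀ a, i < a → a < j → ¬ H.Adj d (r a)) : Obs H w := by
  refine mk hP hd hij hj hodd (s - i) (t - i) (by omega) (by omega) ?_
  intro a ha
  constructor
  · intro h
    by_contra hc
    exact hD (i + a) (by omega) (by omega) h
  · rintro (h | h | h)
    · subst h; exact hi
    · subst h; rwa [show i + (j - i) = j by omega]
    · omega

lemma k0out (hP : Pth H w r N s t) (hd : Out w r N d) {i j : ℕ} (hij : i + 3 ≤ j) (hj : j ≤ N)
    (hodd : Odd (j - i)) (hst : t ≤ s ∨ s < i ∨ j < t)
    (hi : H.Adj d (r i)) (hjd : H.Adj d (r j))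
    (hD : ∀ a, i < a → a < j → ¬ H.Adj d (r a)) : Obs H w := by
  refine mk hP hd hij hj hodd 1 1 (by omega) (by omega) ?_
  intro a ha
  constructor
  · intro h
    by_contra hc
    exact hD (i + a) (by omega) (by omega) h
  · rintro (h | h | h)
    · subst h; exact hi
    · subst h; rwa [show i + (j - i) = j by omega]
    · omega

lemma k1 (hP : Pth H w r N s t) (hd : Out w r N d) {i j l : ℕ} (hij : i + 3 ≤ j) (hj : j ≤ N)
    (hodd : Odd (j - i)) (hst : t ≤ s ∨ s < i ∨ j < t) (hil : i < l) (hlj : l < j)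
    (hi : H.Adj d (r i)) (hjd : H.Adj d (r j)) (hld : H.Adj d (r l))
    (hD : ∀ a, i < a → a < j → a ≠ l → ¬ H.Adj d (r a)) : Obs H w := by
  refine mk hP hd hij hj hodd (l - i) (j - i + 1) (by omega) (by omega) ?_
  intro a ha
  constructor
  · intro h
    by_contra hc
    exact hD (i + a) (by omega) (by omega) (by omega) h
  · rintro (h | h | h)
    · subst h; exact hi
    · subst h; rwa [show i + (j - i) = j by omega]
    · rw [h.1, show i + (l - i) = l by omega]; exact hld

lemma nextN (P : ℕ → Prop) {i N : ℕ} (hi : i < N) (hN : P N) :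
    ∃ j, i < j ∧ j ≤ N ∧ P j ∧ ∀ a, i < a → a < j → ¬ P a := by
  classical
  have hex : ∃ j, i < j ∧ P j := ⟨N, hi, hN⟩
  refine ⟨Nat.find hex, (Nat.find_spec hex).1, Nat.find_min' hex ⟨hi, hN⟩, (Nat.find_spec hex).2, ?_⟩
  intro a ha hlt hp
  exact Nat.find_min hex hlt ⟨ha, hp⟩

lemma prevN (P : ℕ → Prop) {i : ℕ} (hi : 0 < i) (h0 : P 0) :
    ∃ j, j < i ∧ P j ∧ ∀ a, j < a → a < i → ¬ P a := by
  obtain ⟨j, h1, h2, h3, h4⟩ := nextN (fun a => P (i - a)) hi (by simpa using h0)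
  refine ⟨i - j, by omega, h3, ?_⟩
  intro a ha hai hp
  apply h4 (i - a) (by omega) (by omega)
  rwa [show i - (i - a) = a by omega]

lemma lemC (hP : Pth H w r N s t) (hts : t ≤ s) (hd : Out w r N d)
    (h0 : H.Adj d (r 0)) (hN : H.Adj d (r N)) (hO : ¬ Obs H w) :
    (∀ i, i ≤ N → H.Adj d (r i)) ∨ (∀ i, i ≤ N → H.Adj d (r i) → Even i) := by
  by_cases hc : ∃ i, i + 1 ≤ N ∧ H.Adj d (r i) ∧ H.Adj d (r (i + 1))
  · left
    obtain ⟨i, hi, hi1, hi2⟩ := hc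
    have up : ∀ k, i + k + 1 ≤ N → H.Adj d (r (i + k)) ∧ H.Adj d (r (i + k + 1)) := by
      intro k
      induction k with
      | zero => intro _; exact ⟨hi1, hi2⟩
      | succ k ih =>
        intro hk
        obtain ⟨a1, a2⟩ := ih (by omega)
        refine ⟨a2, ?_⟩
        obtain ⟨j, j1, j2, j3, j4⟩ := nextN (fun a => H.Adj d (r a)) (i := i + k + 1) (N := N) (by omega) hN
        by_cases hj : j = i + k + 2
        · subst hj; exact j3
        · exfalso
          rcases Nat.even_or_odd (j - (i + k + 1)) with he | ho
          · refine hO (k1 hP hd (i := i + k) (j := j) (l := i + k + 1) (by omega) j2 ?_ (Or.inl hts) (by omega) j1 a1 j3 a2 ?_)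
            · rw [Nat.even_iff] at he; rw [Nat.odd_iff]; omega
            · intro a _ _ _
              exact j4 a (by omega) (by omega)
          · have := ho
            rw [Nat.odd_iff] at this
            exact hO (k0out hP hd (by omega) j2 ho (Or.inl hts) a2 j3 j4)
    have down : ∀ k, k ≤ i → H.Adj d (r (i - k)) ∧ H.Adj d (r (i - k + 1)) := by
      intro k
      induction k with
      | zero => intro _; exact ⟨hi1, hi2⟩
      | succ k ih =>
        intro hk
        obtain ⟨a1, a2⟩ := ih (by omega)
        refine ⟨?_, by rwa [show i - (k + 1) + 1 = i - k by omega]⟩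
        obtain ⟨j, j1, j3, j4⟩ := prevN (fun a => H.Adj d (r a)) (i := i - k) (by omega) h0
        by_cases hj : j = i - (k + 1)
        · subst hj; exact j3
        · exfalso
          rcases Nat.even_or_odd (i - k - j) with he | ho
          · refine hO (k1 hP hd (i := j) (j := i - k + 1) (l := i - k) (by omega) (by omega) ?_ (Or.inl hts) (by omega) (by omega) j3 a2 a1 ?_)
            · rw [Nat.even_iff] at he; rw [Nat.odd_iff]; omega
            · intro a _ _ _
              exact j4 a (by omega) (by omega)
          · have := ho
            rw [Nat.odd_iff] at this
            exact hO (k0out hP hd (by omega) (by omega) ho (Or.inl hts) j3 a1 j4)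
    intro k hk
    by_cases hki : k ≤ i
    · have := (down (i - k) (by omega)).1
      rwa [show i - (i - k) = k by omega] at this
    · have := (up (k - i - 1) (by omega)).2
      rwa [show i + (k - i - 1) + 1 = k by omega] at this
  · right
    intro i
    induction i using Nat.strong_induction_on with
    | _ i ih =>
      intro hi hdi
      rcases Nat.eq_zero_or_pos i with h | h
      · subst h; simp
      obtain ⟨j, j1, j3, j4⟩ := prevN (fun a => H.Adj d (r a)) h h0
      have hj := ih j j1 (by omega) j3
      by_contra hcon
      have ho : Odd (i - j) := by
        rw [Nat.even_iff] at hj hcon; rw [Nat.odd_iff]; omega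
      by_cases h1 : i = j + 1
      · subst h1; exact hc ⟨j, hi, j3, hdi⟩
      · have := ho
        rw [Nat.odd_iff] at this
        exact hO (k0out hP hd (by omega) hi ho (Or.inl hts) j3 hdi j4)

/-- shortcut along the chord -/
lemma shortcut (hP : Pth H w r N s t) (hst : s + 2 ≤ t) (htN : t ≤ N) :
    Pth H w (fun i => if i ≤ s then r i else r (i + (t - s - 1))) (N - (t - s - 1)) 0 0 := by
  obtain ⟨p1, p2, p3⟩ := hP
  refine ⟨?_, ?_, ?_⟩
  · intro i j hij hj
    by_cases h1 : i ≤ s <;> by_cases h2 : j ≤ s <;> simp only [h1, h2, if_true, if_false] <;>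
      first | omega | exact p1 _ _ (by omega) (by omega)
  · intro i hi hN
    by_cases h1 : i ≤ s <;> simp only [h1, if_true, if_false] <;> exact p2 _ (by omega) (by omega)
  · intro i j hij hj
    by_cases h1 : i ≤ s <;> by_cases h2 : j ≤ s <;> simp only [h1, h2, if_true, if_false] <;>
      first | omega | (rw [p3 _ _ (by omega) (by omega)]; omega)

lemma lemT (hP : Pth H w r N s (s + 2)) (hs : 1 ≤ s) (hsN : s + 3 ≤ N) (hNo : Odd N)
    (hd : Out w r N d) (h0 : H.Adj d (r 0)) (hN : H.Adj d (r N)) {e : ℕ} (he : e ≤ N)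
    (hes : e ≠ s + 1) (hed : ¬ H.Adj d (r e)) : Obs H w := by
  by_contra hO
  have hQ := shortcut hP (le_refl _) (by omega)
  have hk : s + 2 - s - 1 = 1 := by omega
  rw [hk] at hQ
  rw [Nat.odd_iff] at hNo
  have key := lemC hQ (le_refl _) (d := d) ⟨hd.1, ?_⟩ ?_ ?_ hO
  rotate_left
  · intro i hi
    by_cases h1 : i ≤ s <;> simp only [h1, if_true, if_false] <;> exact hd.2 _ (by omega)
  · simpa using h0
  · have : ¬ (N - 1 ≤ s) := by omega
    simp only [this, if_false]
    rwa [show N - 1 + 1 = N by omega]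
  rcases key with key | key
  · by_cases h1 : e ≤ s
    · have := key e (by omega)
      simp only [h1, if_true] at this
      exact hed this
    · have := key (e - 1) (by omega)
      have h2 : ¬ (e - 1 ≤ s) := by omega
      simp only [h2, if_false] at this
      rw [show e - 1 + 1 = e by omega] at this
      exact hed this
  have lo : ∀ i, i ≤ s → H.Adj d (r i) → i % 2 = 0 := by
    intro i hi h
    have := key i (by omega)
    simp only [hi, if_true] at this
    exact Nat.even_iff.1 (this h)
  have hi : ∀ i, s + 2 ≤ i → i ≤ N → H.Adj d (r i) → i % 2 = 1 := by
    intro i hi hiN h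
    have := key (i - 1) (by omega)
    have h2 : ¬ (i - 1 ≤ s) := by omega
    simp only [h2, if_false] at this
    rw [show i - 1 + 1 = i by omega] at this
    have := Nat.even_iff.1 (this h)
    omega
  obtain ⟨i, i1, i3, i4⟩ := prevN (fun a => H.Adj d (r a)) (i := s + 1) (by omega) h0
  obtain ⟨j, j1, j2, j3, j4⟩ := nextN (fun a => H.Adj d (r a)) (i := s + 1) (N := N) (by omega) hN
  have hip := lo i (by omega) i3
  have hjp := hi j (by omega) j2 j3
  by_cases hm : H.Adj d (r (s + 1))
  · rcases Nat.mod_two_eq_zero_or_one (s + 1) with hpar | hpar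
    · have hj : j = s + 2 := by
        by_contra hne
        exact hO (k0out hP hd (i := s + 1) (j := j) (by omega) j2 (by rw [Nat.odd_iff]; omega)
          (by omega) hm j3 j4)
      subst hj
      obtain ⟨k, k1', k2, k3, k4⟩ := nextN (fun a => H.Adj d (r a)) (i := s + 2) (N := N) (by omega) hN
      have hkp := hi k (by omega) k2 k3
      exact hO (k1 hP hd (i := s + 1) (j := k) (l := s + 2) (by omega) k2 (by rw [Nat.odd_iff]; omega)
        (by omega) (by omega) k1' hm k3 j3 (fun a _ _ _ => k4 a (by omega) (by omega)))
    · have hj : i = s := by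
        by_contra hne
        exact hO (k0out hP hd (i := i) (j := s + 1) (by omega) (by omega) (by rw [Nat.odd_iff]; omega)
          (by omega) i3 hm i4)
      subst hj
      obtain ⟨k, k1', k3, k4⟩ := prevN (fun a => H.Adj d (r a)) (i := i) (by omega) h0
      have hkp := lo k (by omega) k3
      exact hO (k1 hP hd (i := k) (j := i + 1) (l := i) (by omega) (by omega) (by rw [Nat.odd_iff]; omega)
        (by omega) (by omega) (by omega) k3 hm i3 (fun a _ _ _ => k4 a (by omega) (by omega)))
  · refine hO (k0in hP hd (i := i) (j := j) (by omega) j2 (by rw [Nat.odd_iff]; omega) hs (by omega)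
      (by omega) (by omega) i3 j3 ?_)
    intro a ha1 ha2
    rcases lt_trichotomy a (s + 1) with h | h | h
    · exact i4 a ha1 h
    · subst h; exact hm
    · exact j4 a h ha2

/-- maximality property -/
def MaxC (H : SimpleGraph U) (w x : U) : Prop :=
  ∀ y a, y ≠ w → ¬ H.Adj w y → H.Adj w a → H.Adj y a → ¬ H.Adj x a →
    ∃ d, H.Adj w d ∧ H.Adj x d ∧ ¬ H.Adj y d

lemma outOf (hP : Pth H w r N s t) (hs : t ≤ s ∨ (1 ≤ s ∧ t < N)) (hN : 3 ≤ N)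
    (hw : H.Adj (r 0) d) (hx : H.Adj (r N) d) (hr : r 0 = w) : Out w r N d := by
  refine ⟨fun h => ?_, fun i hi h => ?_⟩
  · subst h; rw [hr] at hw; exact H.irrefl hw
  · subst h
    rcases Nat.eq_zero_or_pos i with h0 | h0
    · subst h0; exact H.irrefl hw
    rcases Nat.lt_or_ge i N with h1 | h1
    · have e1 := (hP.2.2 0 i h0 hi).1 hw
      have e2 := (hP.2.2 i N h1 le_rfl).1 hx.symm
      omega
    · have : i = N := by omega
      subst this; exact H.irrefl hx

lemma main_none (hP : Pth H w r N 0 0) (hN : 3 ≤ N) (hNo : Odd N) (hr : r 0 = w)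
    (hM : MaxC H w (r N)) : Obs H w := by
  by_contra hO
  obtain ⟨d, d1, d2, d3⟩ := hM (r 2) (r 1) (hP.2.1 2 (by omega) (by omega))
    (by rw [← hr, hP.2.2 0 2 (by omega) (by omega)]; omega)
    (by rw [← hr, hP.2.2 0 1 (by omega) (by omega)]; omega)
    (by rw [H.adj_comm, hP.2.2 1 2 (by omega) (by omega)]; omega)
    (by rw [H.adj_comm, hP.2.2 1 N (by omega) (by omega)]; omega)
  rw [← hr] at d1
  have hd := outOf hP (by omega) hN d1 d2 hr
  rcases lemC hP le_rfl hd d1.symm d2.symm hO with h | h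
  · exact d3 (h 2 (by omega)).symm
  · have := h N le_rfl d2.symm
    rw [Nat.even_iff] at this
    rw [Nat.odd_iff] at hNo
    omega

lemma main2 (hP : Pth H w r N s t) (hN : 5 ≤ N) (hNo : Odd N) (hr : r 0 = w)
    (hst : t ≤ s + 1 ∨ (1 ≤ s ∧ t < N)) (hM : MaxC H w (r N)) : Obs H w := by
  by_cases h1 : t ≤ s + 1
  · refine main_none (N := N) (r := r) ⟨hP.1, hP.2.1, ?_⟩ (by omega) hNo hr hM
    intro i j hij hj
    rw [hP.2.2 i j hij hj]; omega
  have hst : 1 ≤ s ∧ t < N := by omega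
  by_cases h2 : t = s + 2
  · subst h2
    have hx : ¬ H.Adj (r N) (r 1) := by
      rw [H.adj_comm, hP.2.2 1 N (by omega) (by omega)]; omega
    have hw : H.Adj w (r 1) := by
      rw [← hr, hP.2.2 0 1 (by omega) (by omega)]; omega
    have : ∃ e, (e = 2 ∨ e = 3) ∧ e ≠ s + 1 ∧ H.Adj (r 1) (r e) := by
      by_cases hs1 : s = 1
      · refine ⟨3, by omega, by omega, ?_⟩
        rw [hP.2.2 _ _ (by omega) (by omega)]; omega
      · refine ⟨2, by omega, by omega, ?_⟩
        rw [hP.2.2 _ _ (by omega) (by omega)]; omega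
    obtain ⟨e, he, hes, h1e⟩ := this
    obtain ⟨d, d1, d2, d3⟩ := hM (r e) (r 1) (hP.2.1 e (by omega) (by omega))
      (by rw [← hr, hP.2.2 0 e (by omega) (by omega)]; omega) hw h1e.symm hx
    rw [← hr] at d1
    have hd := outOf hP (by omega) (by omega) d1 d2 hr
    exact lemT hP hst.1 (by omega) hNo hd d1.symm d2.symm (e := e) (by omega) hes
      (fun h => d3 h.symm)
  rcases Nat.even_or_odd (t - s) with he | ho
  · rw [Nat.even_iff] at he
    refine ⟨t - s + 1, fun i => r (s + i), 1, 1, by rw [Nat.odd_iff]; omega, by omega, ?_, ?_, ?_, ?_⟩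
    · intro i j hij hj; exact hP.1 _ _ (by omega) (by omega)
    · intro i hi hj; exact hP.2.1 _ (by omega) (by omega)
    · intro _; exact le_rfl
    · intro i j hij hj
      simp only
      rw [hP.2.2 _ _ (by omega) (by omega)]; omega
  · rw [Nat.odd_iff] at ho hNo
    have hQ := shortcut hP (by omega) (by omega)
    refine main_none hQ (by omega) (by rw [Nat.odd_iff]; omega) ?_ ?_
    · simpa using hr
    · have : ¬ (N - (t - s - 1) ≤ s) := by omega
      simp only [this, if_false]
      rwa [show N - (t - s - 1) + (t - s - 1) = N by omega]

end

section
variable {U : Type*} {H H' : SimpleGraph U} {w x : U}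

/-- cycle data through `w` in `H'` -/
def Cyc (H' : SimpleGraph U) (w : U) (m : ℕ) (c : ℕ → U) (s t : ℕ) : Prop :=
  Odd m ∧ 5 ≤ m ∧ (∀ i j, i < j → j < m → c i ≠ c j) ∧
    (∀ i, 0 < i → i < m → c i ≠ w) ∧ c 0 = w ∧ 1 ≤ s ∧ s ≤ t ∧ t < m ∧
    (∀ i j, i < j → j < m →
      (H'.Adj (c i) (c j) ↔ (j = i + 1 ∨ (i = 0 ∧ j + 1 = m) ∨ (i = s ∧ j = t))))

lemma Cyc.rev {m : ℕ} {c : ℕ → U} {s t : ℕ} (h : Cyc H' w m c s t) :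
    Cyc H' w m (fun i => if i = 0 then c 0 else c (m - i)) (m - t) (m - s) := by
  obtain ⟨a1, a2, a3, a4, a5, a6, a7, a8, a9⟩ := h
  refine ⟨a1, a2, ?_, ?_, ?_, by omega, by omega, by omega, ?_⟩
  · intro i j hij hj
    have hj0 : j ≠ 0 := by omega
    by_cases hi : i = 0
    · simp only [hi, hj0, if_true, if_false, true_and]
      exact a3 _ _ (by omega) (by omega)
    · simp only [hi, hj0, if_false, false_and, false_or]
      exact (a3 _ _ (by omega) (by omega)).symm
  · intro i hi him
    have hj0 : i ≠ 0 := by omega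
    simp only [hj0, if_false]
    exact a4 _ (by omega) (by omega)
  · simpa using a5
  · intro i j hij hj
    have hj0 : j ≠ 0 := by omega
    by_cases hi : i = 0
    · simp only [hi, hj0, if_true, if_false, true_and]
      rw [a9 _ _ (by omega) (by omega)]
      constructor <;> intro h <;> omega
    · simp only [hi, hj0, if_false, false_and, false_or]
      rw [H'.adj_comm, a9 _ _ (by omega) (by omega)]
      constructor <;> intro h <;> omega

lemma mixed_s5 (hxw : x ≠ w) (hwx : ¬ H.Adj w x)
    (h1 : ∀ a b, a ≠ w → a ≠ x → b ≠ w → b ≠ x → (H'.Adj a b ↔ H.Adj a b))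
    (h3 : ∀ b, b ≠ w → b ≠ x → (H'.Adj w b ↔ H.Adj w b ∨ H.Adj x b))
    (hM : MaxC H w x) {m : ℕ} {c : ℕ → U} {s t : ℕ} (h : Cyc H' w m c s t)
    (hx : ∀ i, i < m → c i ≠ x)
    (p1 : H.Adj w (c 1)) (p2 : ¬ H.Adj x (c 1)) (p3 : H.Adj x (c (m - 1)))
    (p4 : ¬ H.Adj w (c (m - 1))) : Obs H w := by
  obtain ⟨a1, a2, a3, a4, a5, a6, a7, a8, a9⟩ := h
  have hin : ∀ i, 1 < i → i < m - 1 → ¬ H.Adj w (c i) ∧ ¬ H.Adj x (c i) := by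
    intro i hi him
    have e1 := a9 0 i (by omega) (by omega)
    rw [a5, h3 _ (a4 i (by omega) (by omega)) (hx i (by omega))] at e1
    have : ¬ (H.Adj w (c i) ∨ H.Adj x (c i)) := by rw [e1]; omega
    tauto
  refine main2 (N := m) (r := fun i => if i < m then c i else x) (s := s) (t := t) ⟨?_, ?_, ?_⟩ a2 a1
    ?_ (by omega) (by simpa using hM)
  · intro i j hij hj
    have hi : i < m := by omega
    by_cases hjm : j < m
    · simp only [hi, hjm, if_true]; exact a3 _ _ hij hjm
    · simp only [hi, hjm, if_true, if_false]; exact hx _ hi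
  · intro i hi him
    by_cases hjm : i < m
    · simp only [hjm, if_true]; exact a4 _ hi hjm
    · simp only [hjm, if_false]; exact hxw
  · intro i j hij hj
    have hi : i < m := by omega
    by_cases hjm : j < m
    · simp only [hi, hjm, if_true]
      rcases Nat.eq_zero_or_pos i with h0 | h0
      · subst h0
        rw [a5]
        by_cases j1 : j = 1
        · subst j1; exact iff_of_true p1 (by omega)
        by_cases j2 : j = m - 1
        · subst j2; exact iff_of_false p4 (by omega)
        exact iff_of_false (hin j (by omega) (by omega)).1 (by omega)
      · rw [← h1 _ _ (a4 i h0 hi) (hx i hi) (a4 j (by omega) hjm) (hx j hjm), a9 i j hij hjm]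
        omega
    · simp only [hi, hjm, if_true, if_false]
      rw [H.adj_comm]
      by_cases i0 : i = 0
      · subst i0
        rw [a5]
        exact iff_of_false (fun h => hwx h.symm) (by omega)
      by_cases j1 : i = 1
      · subst j1; exact iff_of_false p2 (by omega)
      by_cases j2 : i = m - 1
      · subst j2; exact iff_of_true p3 (by omega)
      exact iff_of_false (hin i (by omega) (by omega)).2 (by omega)
  · have : 0 < m := by omega
    simp only [this, if_true]; exact a5

lemma step_s5 (hxw : x ≠ w) (hwx : ¬ H.Adj w x)
    (h1 : ∀ a b, a ≠ w → a ≠ x → b ≠ w → b ≠ x → (H'.Adj a b ↔ H.Adj a b))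
    (h2 : ∀ a, ¬ H'.Adj x a)
    (h3 : ∀ b, b ≠ w → b ≠ x → (H'.Adj w b ↔ H.Adj w b ∨ H.Adj x b))
    (hM : MaxC H w x) (hO : Obs H' w) : Obs H w := by
  obtain ⟨m, c, s, t, a1, a2, a3, a4, a6, a9⟩ := hO
  have hx : ∀ i, i < m → c i ≠ x := by
    intro i hi hc
    by_cases him : i + 1 < m
    · have := (a9 i (i + 1) (by omega) him).2 (by omega)
      rw [hc] at this; exact h2 _ this
    · have := (a9 (i - 1) i (by omega) (by omega)).2 (by omega)
      rw [hc] at this; exact h2 _ this.symm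
  by_cases hc0 : c 0 = w
  swap
  · refine ⟨m, c, s, t, a1, a2, a3, a4, a6, ?_⟩
    have hw : ∀ i, i < m → c i ≠ w := by
      intro i hi
      rcases Nat.eq_zero_or_pos i with h | h
      · subst h; exact hc0
      · exact a4 i h hi
    intro i j hij hj
    rw [← h1 _ _ (hw i (by omega)) (hx i (by omega)) (hw j hj) (hx j hj)]
    exact a9 i j hij hj
  have hs := a6 hc0
  obtain ⟨s', t', hcyc⟩ : ∃ s' t', Cyc H' w m c s' t' := by
    by_cases hst : s ≤ t ∧ t < m
    · exact ⟨s, t, a1, a2, a3, a4, hc0, hs, hst.1, hst.2, a9⟩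
    · refine ⟨1, 1, a1, a2, a3, a4, hc0, le_rfl, le_rfl, by omega, ?_⟩
      intro i j hij hj
      rw [a9 i j hij hj]; omega
  clear a6 a9 hs
  obtain ⟨-, -, -, -, -, a6, a7, a8, a9⟩ := id hcyc
  have hE : ∀ i, 0 < i → i < m → (H.Adj w (c i) ∨ H.Adj x (c i) ↔ (i = 1 ∨ i + 1 = m)) := by
    intro i hi him
    rw [← h3 _ (a4 i hi him) (hx i him), ← hc0, a9 0 i hi him]
    constructor <;> intro h <;> omega
  have hin : ∀ i j, 0 < i → i < j → j < m → (H.Adj (c i) (c j) ↔ (j = i + 1 ∨ (i = s' ∧ j = t'))) := by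
    intro i j h0 hij hj
    rw [← h1 _ _ (a4 i h0 (by omega)) (hx i (by omega)) (a4 j (by omega) hj) (hx j hj), a9 i j hij hj]
    constructor <;> intro h <;> omega
  have e1 := (hE 1 (by omega) (by omega)).2 (by omega)
  have e2 := (hE (m - 1) (by omega) (by omega)).2 (by omega)
  by_cases hw : H.Adj w (c 1) ∧ H.Adj w (c (m - 1))
  · refine ⟨m, c, s', t', a1, a2, a3, a4, fun _ => a6, ?_⟩
    intro i j hij hj
    rcases Nat.eq_zero_or_pos i with h0 | h0
    · subst h0
      rw [hc0]
      by_cases j1 : j = 1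
      · subst j1; exact iff_of_true hw.1 (by omega)
      by_cases j2 : j = m - 1
      · subst j2; exact iff_of_true hw.2 (by omega)
      refine iff_of_false (fun h => ?_) (by omega)
      have := (hE j (by omega) hj).1 (Or.inl h)
      omega
    · rw [hin i j h0 hij hj]; omega
  by_cases hxx : H.Adj x (c 1) ∧ H.Adj x (c (m - 1))
  · refine ⟨m, fun i => if i = 0 then x else c i, s', t', a1, a2, ?_, ?_, fun _ => a6, ?_⟩
    · intro i j hij hj
      have hj0 : j ≠ 0 := by omega
      by_cases hi : i = 0
      · simp only [hi, hj0, if_true, if_false, true_and]; exact (hx j hj).symm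
      · simp only [hi, hj0, if_false, false_and, false_or]; exact a3 i j hij hj
    · intro i hi him
      have hj0 : i ≠ 0 := by omega
      simp only [hj0, if_false]; exact a4 i hi him
    · intro i j hij hj
      have hj0 : j ≠ 0 := by omega
      by_cases hi : i = 0
      · simp only [hi, hj0, if_true, if_false, true_and]
        by_cases j1 : j = 1
        · subst j1; exact iff_of_true hxx.1 (by omega)
        by_cases j2 : j = m - 1
        · subst j2; exact iff_of_true hxx.2 (by omega)
        refine iff_of_false (fun h => ?_) (by omega)
        have := (hE j (by omega) hj).1 (Or.inr h)
        omega
      · simp only [hi, hj0, if_false, false_and, false_or]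
        rw [hin i j (by omega) hij hj]
  by_cases hw1 : H.Adj w (c 1)
  · have q4 : ¬ H.Adj w (c (m - 1)) := fun h => hw ⟨hw1, h⟩
    have q3 : H.Adj x (c (m - 1)) := e2.resolve_left q4
    have q2 : ¬ H.Adj x (c 1) := fun h => hxx ⟨h, q3⟩
    exact mixed_s5 hxw hwx h1 h3 hM hcyc hx hw1 q2 q3 q4
  · have q1 : H.Adj x (c 1) := e1.resolve_left hw1
    have q2 : ¬ H.Adj x (c (m - 1)) := fun h => hxx ⟨q1, h⟩
    have q3 : H.Adj w (c (m - 1)) := e2.resolve_right q2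
    have m1 : m - 1 ≠ 0 := by omega
    have m2 : m - (m - 1) = 1 := by omega
    refine mixed_s5 hxw hwx h1 h3 hM hcyc.rev ?_ ?_ ?_ ?_ ?_
    · intro i hi
      by_cases hi0 : i = 0
      · simp only [hi0, if_true]; exact hx 0 (by omega)
      · simp only [hi0, if_false]; exact hx _ (by omega)
    · simpa using q3
    · simpa using q2
    · simp only [m1, m2, if_false]; exact q1
    · simp only [m1, m2, if_false]; exact hw1

end

section
variable {V : Type*}

/-- contraction of the set `S` -/
def con (G : SimpleGraph V) (S : Set V) : SimpleGraph (Option V) where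
  Adj p q := match p, q with
    | none, none => False
    | none, some b => b ∉ S ∧ ∃ a ∈ S, G.Adj b a
    | some b, none => b ∉ S ∧ ∃ a ∈ S, G.Adj b a
    | some a, some b => a ∉ S ∧ b ∉ S ∧ G.Adj a b
  symm := ⟨by
    rintro (_ | a) (_ | b) h
    · exact h
    · exact h
    · exact h
    · exact ⟨h.2.1, h.1, h.2.2.symm⟩⟩
  loopless := ⟨by
    rintro (_ | a) h
    · exact h
    · exact G.irrefl h.2.2⟩

lemma con_ns {G : SimpleGraph V} {S : Set V} {b : V} :
    (con G S).Adj none (some b) ↔ b ∉ S ∧ ∃ a ∈ S, G.Adj b a := Iff.rfl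
lemma con_ss {G : SimpleGraph V} {S : Set V} {a b : V} :
    (con G S).Adj (some a) (some b) ↔ a ∉ S ∧ b ∉ S ∧ G.Adj a b := Iff.rfl

lemma con_step {G : SimpleGraph V} {S : Set V} {x : V} (hxS : x ∉ S)
    (hxn : ∀ a ∈ S, ¬ G.Adj x a) (hM : MaxC (con G S) none (some x))
    (hO : ¬ Obs (con G S) none) : ¬ Obs (con G (insert x S)) none := by
  intro h
  apply hO
  refine step_s5 (x := some x) (by simp) ?_ ?_ ?_ ?_ hM h
  · rw [con_ns]; rintro ⟨-, a, ha, hx⟩; exact hxn a ha hx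
  · rintro (_ | a) (_ | b) ha hax hb hbx <;> try contradiction
    have : a ≠ x := fun h => hax (by rw [h])
    have : b ≠ x := fun h => hbx (by rw [h])
    simp only [con_ss, Set.mem_insert_iff]; tauto
  · rintro (_ | a) h
    · exact h.1 (Set.mem_insert _ _)
    · exact h.1 (Set.mem_insert _ _)
  · rintro (_ | b) hb hbx
    · contradiction
    have hbx' : b ≠ x := fun h => hbx (by rw [h])
    simp only [con_ns, con_ss, Set.mem_insert_iff, exists_eq_or_imp, G.adj_comm x b]
    generalize (∃ a ∈ S, G.Adj b a) = Q
    tauto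

/-- functional obstruction gives a genuine one -/
lemma toCycle [Finite V] (G : SimpleGraph V) (m : ℕ) (c : ℕ → V) (s t : ℕ) (hm : Odd m) (h5 : 5 ≤ m)
    (hinj : ∀ i j, i < j → j < m → c i ≠ c j)
    (hadj : ∀ i j, i < j → j < m →
      (G.Adj (c i) (c j) ↔ (j = i + 1 ∨ (i = 0 ∧ j + 1 = m) ∨ (i = s ∧ j = t)))) :
    G.HasMeynielObstruction := by
  have hinj' : ∀ i j, i < m → j < m → c i = c j → i = j := by
    intro i j hi hj h
    rcases lt_trichotomy i j with h1 | h1 | h1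
    · exact absurd h (hinj i j h1 hj)
    · exact h1
    · exact absurd h.symm (hinj j i h1 hi)
  have path : ∀ k, k < m → ∃ p : G.Walk (c k) (c 0), p.IsPath ∧ p.length = k ∧
      (∀ y, y ∈ p.support ↔ ∃ i, i ≤ k ∧ c i = y) ∧
      (∀ e, e ∈ p.edges ↔ ∃ i, i < k ∧ e = s(c i, c (i + 1))) := by
    intro k
    induction k with
    | zero =>
      intro _
      refine ⟨Walk.nil, by simp, rfl, ?_, by simp⟩
      intro y; simp [eq_comm]
    | succ k ih =>
      intro hk
      obtain ⟨p, q1, q2, q3, q4⟩ := ih (by omega)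
      have ha : G.Adj (c (k + 1)) (c k) := ((hadj k (k + 1) (by omega) hk).2 (by omega)).symm
      refine ⟨Walk.cons ha p, ?_, by simp [q2], ?_, ?_⟩
      · rw [Walk.cons_isPath_iff]
        refine ⟨q1, ?_⟩
        rw [q3]
        rintro ⟨i, hi, h⟩
        exact hinj i (k + 1) (by omega) hk h
      · intro y
        rw [Walk.support_cons, List.mem_cons, q3]
        constructor
        · rintro (h | ⟨i, hi, h⟩)
          · exact ⟨k + 1, le_rfl, h.symm⟩
          · exact ⟨i, by omega, h⟩
        · rintro ⟨i, hi, h⟩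
          rcases Nat.lt_or_ge i (k + 1) with h1 | h1
          · right; exact ⟨i, by omega, h⟩
          · left; rw [← h, show i = k + 1 by omega]
      · intro e
        rw [Walk.edges_cons, List.mem_cons, q4]
        constructor
        · rintro (h | ⟨i, hi, h⟩)
          · exact ⟨k, by omega, by rw [h, Sym2.eq_swap]⟩
          · exact ⟨i, by omega, h⟩
        · rintro ⟨i, hi, h⟩
          rcases Nat.lt_or_ge i k with h1 | h1
          · right; exact ⟨i, by omega, h⟩
          · left; rw [h, show i = k by omega, Sym2.eq_swap]
  obtain ⟨p, q1, q2, q3, q4⟩ := path (m - 1) (by omega)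
  have ha : G.Adj (c 0) (c (m - 1)) := (hadj 0 (m - 1) (by omega) (by omega)).2 (by omega)
  refine ⟨c 0, Walk.cons ha p, ?_, ?_, ?_, ?_⟩
  · rw [Walk.cons_isCycle_iff]
    refine ⟨q1, ?_⟩
    rw [q4]
    rintro ⟨i, hi, h⟩
    rw [Sym2.eq_iff] at h
    rcases h with ⟨h1, h2⟩ | ⟨h1, h2⟩
    · have e1 := hinj' _ _ (by omega) (by omega) h1
      have e2 := hinj' _ _ (by omega) (by omega) h2
      omega
    · have e1 := hinj' _ _ (by omega) (by omega) h1
      omega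
  · rw [Walk.length_cons, q2, show m - 1 + 1 = m by omega]; exact hm
  · rw [Walk.length_cons, q2]; omega
  · have hsub : G.cycleChords (Walk.cons ha p) ⊆ {s(c s, c t)} := by
      intro e he
      obtain ⟨e1, e2, e3⟩ := he
      have key : ∀ i j, i < j → j < m → G.Adj (c i) (c j) →
          s(c i, c j) ∉ (Walk.cons ha p).edges → s(c i, c j) = s(c s, c t) := by
        intro i j hij hj h hn
        rw [Walk.edges_cons, List.mem_cons, q4] at hn
        rcases (hadj i j hij hj).1 h with h | h | h
        · exact absurd (Or.inr ⟨i, by omega, by rw [h]⟩) hn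
        · exact absurd (Or.inl (by rw [h.1, show j = m - 1 by omega])) hn
        · rw [h.1, h.2]
      have hsup : ∀ y, y ∈ (Walk.cons ha p).support → ∃ i, i < m ∧ c i = y := by
        intro y hy
        rw [Walk.support_cons, List.mem_cons, q3] at hy
        rcases hy with h | ⟨i, hi, h⟩
        · exact ⟨0, by omega, h.symm⟩
        · exact ⟨i, by omega, h⟩
      induction e using Sym2.ind with
      | _ a b =>
        obtain ⟨i, hi, rfl⟩ := hsup a (e2 a (by simp))
        obtain ⟨j, hj, rfl⟩ := hsup b (e2 b (by simp))
        rw [mem_edgeSet] at e1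
        rcases lt_trichotomy i j with h | h | h
        · exact key i j h hj e1 e3
        · subst h; exact absurd e1 (G.irrefl)
        · have hsw : s(c i, c j) = s(c j, c i) := Sym2.eq_swap
          rw [hsw] at e3 ⊢
          exact key j i h hi e1.symm e3
    calc _ ≤ ({s(c s, c t)} : Set (Sym2 V)).ncard := Set.ncard_le_ncard hsub
      _ = 1 := Set.ncard_singleton _

lemma base [Finite V] {G : SimpleGraph V} {v : V} (hO : Obs (con G {v}) none) :
    G.HasMeynielObstruction := by
  obtain ⟨m, c, s, t, a1, a2, a3, a4, a6, a9⟩ := hO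
  have hne : ∀ i, i < m → c i ≠ some v := by
    have hiso : ∀ q, ¬ (con G {v}).Adj (some v) q := by
      rintro (_ | q) h
      · exact h.1 rfl
      · exact h.1 rfl
    intro i hi hc
    by_cases him : i + 1 < m
    · have := (a9 i (i + 1) (by omega) him).2 (by omega)
      rw [hc] at this; exact hiso _ this
    · have := (a9 (i - 1) i (by omega) (by omega)).2 (by omega)
      rw [hc] at this; exact hiso _ this.symm
  have hf : ∀ p q : Option V, p ≠ some v → q ≠ some v → p ≠ q → p.getD v ≠ q.getD v := by
    rintro (_ | p) (_ | q) <;> simp <;> tauto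
  have hg : ∀ p q : Option V, p ≠ some v → q ≠ some v →
      (G.Adj (p.getD v) (q.getD v) ↔ (con G {v}).Adj p q) := by
    rintro (_ | p) (_ | q) hp hq
    · simp
    · have : q ≠ v := fun h => hq (by rw [h])
      simp [con_ns, this, G.adj_comm]
    · have : p ≠ v := fun h => hp (by rw [h])
      rw [(con G {v}).adj_comm]
      simp [con_ns, this]
    · have : q ≠ v := fun h => hq (by rw [h])
      have : p ≠ v := fun h => hp (by rw [h])
      simp [con_ss, *]
  refine toCycle G m (fun i => (c i).getD v) s t a1 a2 ?_ ?_
  · intro i j hij hj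
    exact hf _ _ (hne i (by omega)) (hne j hj) (a3 i j hij hj)
  · intro i j hij hj
    rw [hg _ _ (hne i (by omega)) (hne j hj)]
    exact a9 i j hij hj

/-- choice of the next vertex -/
lemma choose_next [Finite V] (G : SimpleGraph V) (S : Set V)
    (hex : ∃ y, y ∉ S ∧ ∀ a ∈ S, ¬ G.Adj y a) :
    ∃ y, y ∉ S ∧ (∀ a ∈ S, ¬ G.Adj y a) ∧ MaxC (con G S) none (some y) := by
  let T : Set V := {y | y ∉ S ∧ ∀ a ∈ S, ¬ G.Adj y a}
  let f : V → Set V := fun y => {a | (con G S).Adj none (some a) ∧ (con G S).Adj (some y) (some a)}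
  obtain ⟨y, hy, hmax⟩ := Set.exists_max_image T (fun y => (f y).ncard) (Set.toFinite _) hex
  refine ⟨y, hy.1, hy.2, ?_⟩
  rintro (_ | z) (_ | a) hz hwz hwa hza hya
  · contradiction
  · contradiction
  · exact absurd hwa ((con G S).irrefl)
  have hzS : z ∉ S := hza.1
  have hzT : z ∈ T := ⟨hzS, fun b hb h => hwz (con_ns.2 ⟨hzS, b, hb, h⟩)⟩
  by_contra hcon
  push Not at hcon
  have hsub : f y ⊂ f z := by
    rw [Set.ssubset_iff_of_subset]
    · exact ⟨a, ⟨hwa, hza⟩, fun h => hya h.2⟩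
    · intro d hd
      exact ⟨hd.1, hcon _ hd.1 hd.2⟩
  have := Set.ncard_lt_ncard hsub
  have := hmax z hzT
  exact absurd this (by simpa using ‹(f y).ncard < (f z).ncard›)

/-- no P4 -/
lemma noP4 {G : SimpleGraph V} {S : Set V} {y : V}
    (hst : ∀ a ∈ S, ∀ b ∈ S, ¬ G.Adj a b) (hyS : y ∉ S)
    (hyn : ∀ a ∈ S, ¬ G.Adj y a) (hM : MaxC (con G S) none (some y))
    (hO : ¬ Obs (con G S) none) (a b : V) (hab : G.Adj a b) (haS : ∃ j ∈ S, G.Adj a j)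
    (hay : ¬ G.Adj a y) (hby : G.Adj b y) (hbS : ∀ j ∈ S, ¬ G.Adj b j) : False := by
  apply hO
  have haS' : a ∉ S := fun h => by
    obtain ⟨j, hj, h'⟩ := haS; exact hst a h j hj h'
  have hbS' : b ∉ S := fun h => hyn b h hby.symm
  have hay' : a ≠ y := fun h => by
    obtain ⟨j, hj, h'⟩ := haS; rw [h] at h'; exact hyn j hj h'
  have e1 : (con G S).Adj none (some a) := ⟨haS', haS⟩
  have e2 : ¬ (con G S).Adj none (some b) := by
    rintro ⟨-, j, hj, h⟩; exact hbS j hj h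
  have e3 : ¬ (con G S).Adj none (some y) := by
    rintro ⟨-, j, hj, h⟩; exact hyn j hj h
  have e4 : (con G S).Adj (some a) (some b) := ⟨haS', hbS', hab⟩
  have e5 : ¬ (con G S).Adj (some a) (some y) := fun h => hay h.2.2
  have e6 : (con G S).Adj (some b) (some y) := ⟨hbS', hyS, hby⟩
  have n1 := hab.ne
  have n2 := hby.ne
  refine main_none (N := 3)
    (r := fun i => if i = 0 then none else if i = 1 then some a else if i = 2 then some b else some y)
    ⟨?_, ?_, ?_⟩ le_rfl (by decide) (by simp) (by simpa using hM)
  · intro i j hij hj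
    have hi : i < 3 := by omega
    interval_cases j <;> interval_cases i <;> simp_all
  · intro i hi hj
    interval_cases i <;> simp
  · intro i j hij hj
    have hi : i < 3 := by omega
    interval_cases j <;> interval_cases i <;> simp_all

/-- state of the construction -/
def Good (G : SimpleGraph V) (v : V) (k : ℕ) (x : ℕ → V) : Prop :=
  1 ≤ k ∧ x 0 = v ∧ (∀ i j, i < j → j < k → x i ≠ x j) ∧
  (∀ i j, i < k → j < k → ¬ G.Adj (x i) (x j)) ∧
  (∀ i, i < k → ¬ ∃ a b : V, G.Adj a b ∧
        (∃ j, j < i ∧ G.Adj a (x j)) ∧ ¬ G.Adj a (x i) ∧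
        G.Adj b (x i) ∧ (∀ j, j < i → ¬ G.Adj b (x j))) ∧
  ¬ Obs (con G {y | ∃ i, i < k ∧ x i = y}) none

lemma Good.extend [Finite V] {G : SimpleGraph V} {v : V} {k : ℕ} {x : ℕ → V} (h : Good G v k x)
    (hex : ∃ y, y ∉ {y | ∃ i, i < k ∧ x i = y} ∧ ∀ a ∈ {y | ∃ i, i < k ∧ x i = y}, ¬ G.Adj y a) :
    ∃ x', Good G v (k + 1) x' := by
  obtain ⟨g1, g2, g3, g4, g5, g6⟩ := h
  obtain ⟨y, y1, y2, y3⟩ := choose_next G _ hex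
  set S := {y | ∃ i, i < k ∧ x i = y} with hS
  have hmem : ∀ i, i < k → x i ∈ S := fun i hi => ⟨i, hi, rfl⟩
  let x' : ℕ → V := fun i => if i < k then x i else y
  have hlt : ∀ i, i < k → x' i = x i := fun i hi => if_pos hi
  have hk : x' k = y := if_neg (lt_irrefl k)
  refine ⟨x', by omega, by rw [hlt 0 (by omega)]; exact g2, ?_, ?_, ?_, ?_⟩
  · intro i j hij hj
    rw [hlt i (by omega)]
    rcases Nat.lt_or_ge j k with h | h
    · rw [hlt j h]; exact g3 i j hij h
    · rw [show j = k by omega, hk]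
      rintro rfl; exact y1 (hmem i (by omega))
  · intro i j hi hj
    rcases Nat.lt_or_ge j k with h | h <;> rcases Nat.lt_or_ge i k with h' | h'
    · rw [hlt j h, hlt i h']; exact g4 i j h' h
    · rw [show i = k by omega, hk, hlt j h]; exact y2 _ (hmem j h)
    · rw [show j = k by omega, hk, hlt i h']; exact fun h => y2 _ (hmem i h') h.symm
    · rw [show j = k by omega, show i = k by omega]; exact G.irrefl
  · intro i hi
    rintro ⟨a, b, b1, ⟨j, b2, b3⟩, b4, b5, b6⟩
    rcases Nat.lt_or_ge i k with h | h
    · refine g5 i h ⟨a, b, b1, ⟨j, b2, ?_⟩, ?_, ?_, ?_⟩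
      · rwa [hlt j (by omega)] at b3
      · rwa [hlt i h] at b4
      · rwa [hlt i h] at b5
      · intro l hl
        have := b6 l hl
        rwa [hlt l (by omega)] at this
    · have hik : i = k := by omega
      subst hik
      rw [hk] at b4 b5
      rw [hlt j b2] at b3
      refine noP4 ?_ y1 y2 y3 g6 a b b1 ⟨_, hmem j b2, b3⟩ b4 b5 ?_
      · rintro _ ⟨p, hp, rfl⟩ _ ⟨q, hq, rfl⟩; exact g4 p q hp hq
      · rintro _ ⟨p, hp, rfl⟩
        have := b6 p hp
        rwa [hlt p hp] at this
  · have := con_step y1 y2 y3 g6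
    have hSS : {y | ∃ i, i < k + 1 ∧ x' i = y} = insert y S := by
      ext z
      constructor
      · rintro ⟨i, hi, rfl⟩
        rcases Nat.lt_or_ge i k with h | h
        · right; rw [hlt i h]; exact hmem i h
        · left; rw [show i = k by omega, hk]
      · rintro (rfl | ⟨i, hi, rfl⟩)
        · exact ⟨k, by omega, hk⟩
        · exact ⟨i, by omega, hlt i hi⟩
    rwa [hSS]

end
end Mey

/-- For any graph `G` and any vertex `v`, either `G` contains a Meyniel
obstruction, or `G` contains a nice stable set containing `v` (or both). -/
theorem hasMeynielObstruction_or_exists_niceStableSet_mem {V : Type*} [Fintype V]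
    (G : SimpleGraph V) (v : V) :
    G.HasMeynielObstruction ∨ ∃ S : Set V, G.IsNiceStableSet S ∧ v ∈ S := by
  classical
  by_cases hG : G.HasMeynielObstruction
  · exact Or.inl hG
  right
  have h1 : Mey.Good G v 1 (fun _ => v) := by
    refine ⟨le_rfl, rfl, by omega, fun _ _ _ _ => G.irrefl, ?_, ?_⟩
    · rintro i hi ⟨a, b, -, ⟨j, hj, -⟩, -⟩
      omega
    · intro h
      apply hG
      have : {y | ∃ i, i < 1 ∧ (fun _ : ℕ => v) i = y} = {v} := by
        ext z
        constructor
        · rintro ⟨_, _, rfl⟩; rfl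
        · rintro rfl; exact ⟨0, by omega, rfl⟩
      rw [this] at h
      exact Mey.base h
  have hbd : ∀ k, (∃ x, Mey.Good G v k x) → k ≤ Fintype.card V := by
    rintro k ⟨x, -, -, hinj, -⟩
    have : Function.Injective (fun i : Fin k => x i) := by
      intro i j h
      rcases lt_trichotomy i j with h' | h' | h'
      · exact absurd h (hinj i j h' j.2)
      · exact h'
      · exact absurd h.symm (hinj j i h' i.2)
    simpa using Fintype.card_le_of_injective _ this
  have hmax : ∃ k, (∃ x, Mey.Good G v k x) ∧ ¬ ∃ x, Mey.Good G v (k + 1) x := by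
    by_contra hcon
    have : ∀ k, ∃ x, Mey.Good G v (k + 1) x := by
      intro k
      induction k with
      | zero => exact ⟨_, h1⟩
      | succ k ih => exact by_contra fun hn => hcon ⟨_, ih, hn⟩
    have := hbd _ (this (Fintype.card V))
    omega
  obtain ⟨k, ⟨x, hx⟩, hno⟩ := hmax
  obtain ⟨g1, g2, g3, g4, g5, g6⟩ := id hx
  refine ⟨{y | ∃ i, i < k ∧ x i = y}, ⟨?_, ?_, k, fun i => x i, ?_, ?_, ?_⟩, ⟨0, by omega, g2⟩⟩
  · rintro _ ⟨i, hi, rfl⟩ _ ⟨j, hj, rfl⟩ _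
    exact g4 i j hi hj
  · intro T hT hST
    refine Set.Subset.antisymm ?_ hST
    intro y hy
    by_contra hyS
    refine hno (hx.extend ⟨y, hyS, ?_⟩)
    intro a ha
    exact hT hy (hST ha) (fun h => hyS (h ▸ ha))
  · intro i j h
    rcases lt_trichotomy i j with h' | h' | h'
    · exact absurd h (g3 i j h' j.2)
    · exact h'
    · exact absurd h.symm (g3 j i h' i.2)
  · ext z
    constructor
    · rintro ⟨i, rfl⟩; exact ⟨i, i.2, rfl⟩
    · rintro ⟨i, hi, rfl⟩; exact ⟨⟨i, hi⟩, rfl⟩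
  · rintro i ⟨a, b, b1, ⟨j, b2, b3⟩, b4, b5, b6⟩
    exact g5 i i.2 ⟨a, b, b1, ⟨j, b2, b3⟩, b4, b5, fun l hl => b6 ⟨l, by omega⟩ hl⟩
end

section
/- Let G be a finite simple graph, let P = v_0-v_1-…-v_p be a path of G with p odd, p ≥ 3, whose only chord is v_1v_3, and let z be a vertex not on P adjacent to v_0 and v_p and adjacent to neither v_1 nor v_2 (a near-obstruction of Type 2 with z nonadjacent to v_1 and v_2). Let r be the smallest integer such that z is adjacent to v_r (so r ≥ 3). If r is odd, then z, v_0, v_1, …, v_r induce an odd cycle whose only chord is v_1v_3; if r is even, then r ≥ 4 and z, v_0, v_1, v_3, v_4, …, v_r induce a chordless odd cycle of length at least five. In either case G contains a Meyniel obstruction. -/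
open SimpleGraph

/-- `v i` and `v j` span a chord of the path `v 0 - v 1 - ⋯ - v p`: an edge of `G`
joining two non-consecutive vertices of the path (with `i < j`). -/
def SimpleGraph.IsPathChord {V : Type*} (G : SimpleGraph V) (p : ℕ) (v : ℕ → V)
    (i j : ℕ) : Prop :=
  i + 2 ≤ j ∧ j ≤ p ∧ G.Adj (v i) (v j)

theorem aux_path {V : Type*} (G : SimpleGraph V) (w : ℕ → V) (n : ℕ)
    (hinj : Set.InjOn w (Set.Iic n)) (hadj : ∀ i, i < n → G.Adj (w i) (w (i + 1))) :
    ∃ W : G.Walk (w 0) (w n), W.IsPath ∧ W.length = n ∧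
      (∀ x, x ∈ W.support ↔ ∃ i, i ≤ n ∧ x = w i) ∧
      (∀ e, e ∈ W.edges ↔ ∃ i, i < n ∧ e = s(w i, w (i + 1))) := by
  induction n with
  | zero => exact ⟨Walk.nil, by simp, by simp, by simp, by simp⟩
  | succ n ih =>
    obtain ⟨W, h1, h2, h3, h4⟩ := ih
      (hinj.mono (by intro x hx; simp at hx ⊢; omega)) (fun i hi => hadj i (by omega))
    refine ⟨W.concat (hadj n (by omega)), ?_, by simp [h2], ?_, ?_⟩
    · refine h1.concat ?_ _
      rw [h3]
      rintro ⟨i, hi, h⟩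
      have := hinj (by simp) (by simp; omega) h
      omega
    · intro x
      simp only [Walk.support_concat, List.concat_eq_append, List.mem_append, h3,
        List.mem_singleton]
      constructor
      · rintro (⟨i, hi, rfl⟩ | rfl)
        · exact ⟨i, by omega, rfl⟩
        · exact ⟨n + 1, le_rfl, rfl⟩
      · rintro ⟨i, hi, rfl⟩
        rcases Nat.lt_or_ge n i with h | h
        · right
          have : i = n + 1 := by omega
          rw [this]
        · exact Or.inl ⟨i, h, rfl⟩
    · intro e
      simp only [Walk.edges_concat, List.concat_eq_append, List.mem_append, h4,
        List.mem_singleton]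
      constructor
      · rintro (⟨i, hi, rfl⟩ | rfl)
        · exact ⟨i, by omega, rfl⟩
        · exact ⟨n, by omega, rfl⟩
      · rintro ⟨i, hi, rfl⟩
        rcases Nat.lt_or_ge i n with h | h
        · exact Or.inl ⟨i, h, rfl⟩
        · right
          have : i = n := by omega
          rw [this]

theorem aux_cycle {V : Type*} (G : SimpleGraph V) (w : ℕ → V) (n : ℕ) (hn : 2 ≤ n)
    (hinj : Set.InjOn w (Set.Iic n)) (hadj : ∀ i, i < n → G.Adj (w i) (w (i + 1)))
    (hc : G.Adj (w n) (w 0)) :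
    ∃ (u : V) (c : G.Walk u u), c.IsCycle ∧ c.length = n + 1 ∧
      (∀ x, x ∈ c.support ↔ ∃ i, i ≤ n ∧ x = w i) ∧
      (∀ e, e ∈ G.cycleChords c ↔ ∃ i j, i + 2 ≤ j ∧ j ≤ n ∧ ¬ (i = 0 ∧ j = n) ∧
        G.Adj (w i) (w j) ∧ e = s(w i, w j)) := by
  obtain ⟨W, h1, h2, h3, h4⟩ := aux_path G w n hinj hadj
  have inj : ∀ i j, i ≤ n → j ≤ n → w i = w j → i = j := fun i j hi hj h => hinj hi hj h
  have hs : ∀ x, x ∈ (Walk.cons hc W).support ↔ ∃ i, i ≤ n ∧ x = w i := by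
    intro x
    simp only [Walk.support_cons, List.mem_cons, h3]
    constructor
    · rintro (rfl | h)
      · exact ⟨n, le_rfl, rfl⟩
      · exact h
    · exact Or.inr
  refine ⟨w n, Walk.cons hc W, ?_, by simp [h2], hs, ?_⟩
  · rw [Walk.cons_isCycle_iff]
    refine ⟨h1, ?_⟩
    rw [h4]
    rintro ⟨i, hi, h⟩
    rw [Sym2.eq_iff] at h
    rcases h with ⟨ha, hb⟩ | ⟨ha, hb⟩
    · have := inj _ _ (by omega) (by omega) ha
      omega
    · have := inj _ _ (by omega) (by omega) ha
      have := inj _ _ (by omega) (by omega) hb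
      omega
  · intro e
    simp only [cycleChords, Set.mem_setOf_eq, hs, Walk.edges_cons, List.mem_cons, h4]
    constructor
    · rintro ⟨he, hx, hne⟩
      induction e using Sym2.ind with
      | _ x y =>
      obtain ⟨i, hi, rfl⟩ := hx x (by simp)
      obtain ⟨j, hj, rfl⟩ := hx y (by simp)
      rw [mem_edgeSet] at he
      push Not at hne
      obtain ⟨hne1, hne2⟩ := hne
      have hij : i ≠ j := by rintro rfl; exact he.ne rfl
      rcases Nat.lt_or_ge i j with h | h
      · refine ⟨i, j, ?_, hj, ?_, he, rfl⟩
        · by_contra h'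
          have : j = i + 1 := by omega
          subst this
          exact hne2 i (by omega) rfl
        · rintro ⟨rfl, rfl⟩
          exact hne1 Sym2.eq_swap
      · refine ⟨j, i, ?_, hi, ?_, he.symm, Sym2.eq_swap⟩
        · by_contra h'
          have : i = j + 1 := by omega
          subst this
          exact hne2 j (by omega) Sym2.eq_swap
        · rintro ⟨rfl, rfl⟩
          exact hne1 rfl
    · rintro ⟨i, j, hij, hj, hne, ha, rfl⟩
      refine ⟨ha, ?_, ?_⟩
      · intro x hx
        rcases Sym2.mem_iff.1 hx with rfl | rfl
        · exact ⟨i, by omega, rfl⟩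
        · exact ⟨j, by omega, rfl⟩
      · rintro (h | ⟨k, hk, h⟩) <;> rw [Sym2.eq_iff] at h <;>
          rcases h with ⟨ha, hb⟩ | ⟨ha, hb⟩ <;>
          have := inj _ _ (by omega) (by omega) ha <;>
          have := inj _ _ (by omega) (by omega) hb <;> omega

/-- Near-obstruction of Type 2 with `z` nonadjacent to `v 1` and `v 2`:
`P = v 0 - ⋯ - v p` is a path with `p` odd, `p ≥ 3`, whose only chord is `v 1 v 3`,
and `z` is a vertex off `P` adjacent to `v 0` and `v p` but to neither `v 1` nor
`v 2`.  If `r` is the smallest positive integer with `z` adjacent to `v r`, then: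
if `r` is odd, `z, v 0, …, v r` induce an odd cycle whose only chord is `v 1 v 3`;
if `r` is even, then `r ≥ 4` and `z, v 0, v 1, v 3, v 4, …, v r` induce a chordless
odd cycle of length at least five.  In either case `G` contains a Meyniel
obstruction. -/
theorem type2_nearObstruction_meynielObstruction {V : Type*} [Fintype V]
    (G : SimpleGraph V) (p : ℕ) (v : ℕ → V) (z : V) (r : ℕ)
    (hodd : Odd p) (hp : 3 ≤ p) (hinj : Set.InjOn v (Set.Iic p))
    (hpath : ∀ i, i < p → G.Adj (v i) (v (i + 1)))
    (hchord : G.Adj (v 1) (v 3))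
    (honly : ∀ i j, G.IsPathChord p v i j → i = 1 ∧ j = 3)
    (hz : ∀ i, i ≤ p → z ≠ v i)
    (hz0 : G.Adj z (v 0)) (hzp : G.Adj z (v p))
    (hz1 : ¬ G.Adj z (v 1)) (hz2 : ¬ G.Adj z (v 2))
    (hr1 : 1 ≤ r) (hrp : r ≤ p) (hzr : G.Adj z (v r))
    (hrmin : ∀ i, 1 ≤ i → i < r → ¬ G.Adj z (v i)) :
    ((Odd r → ∃ (u : V) (c : G.Walk u u), c.IsCycle ∧ Odd c.length ∧
        {x | x ∈ c.support} = insert z (v '' Set.Iic r) ∧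
        G.cycleChords c = {s(v 1, v 3)}) ∧
     (Even r → 4 ≤ r ∧ ∃ (u : V) (c : G.Walk u u), c.IsCycle ∧ Odd c.length ∧
        5 ≤ c.length ∧
        {x | x ∈ c.support} = insert z (insert (v 0) (insert (v 1) (v '' Set.Icc 3 r))) ∧
        G.cycleChords c = ∅)) ∧
    G.HasMeynielObstruction := by
  have inj : ∀ i j, i ≤ p → j ≤ p → v i = v j → i = j := fun i j hi hj h => hinj hi hj h
  have r1 : r ≠ 1 := by rintro rfl; exact hz1 hzr
  have r2 : r ≠ 2 := by rintro rfl; exact hz2 hzr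
  have A : Odd r → ∃ (u : V) (c : G.Walk u u), c.IsCycle ∧ c.length = r + 2 ∧
        {x | x ∈ c.support} = insert z (v '' Set.Iic r) ∧
        G.cycleChords c = {s(v 1, v 3)} := by
    intro ho
    let w : ℕ → V := fun i => if i = 0 then z else v (i - 1)
    have w0 : w 0 = z := rfl
    have ws : ∀ i, w (i + 1) = v i := fun i => by simp [w]
    obtain ⟨u, c, h1, h2, h3, h4⟩ := aux_cycle G w (r + 1) (by omega) (by
      intro i hi j hj h
      simp only [Set.mem_Iic] at hi hj
      rcases i with _ | i <;> rcases j with _ | j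
      · rfl
      · rw [w0, ws] at h
        exact absurd h (hz _ (by omega))
      · rw [w0, ws] at h
        exact absurd h.symm (hz _ (by omega))
      · rw [ws, ws] at h
        rw [inj _ _ (by omega) (by omega) h]) (by
      intro i hi
      rcases i with _ | i
      · rw [ws]; exact hz0
      · rw [ws, ws]; exact hpath i (by omega)) (by
      rw [ws]; exact hzr.symm)
    refine ⟨u, c, h1, h2, ?_, ?_⟩
    · ext x
      simp only [Set.mem_setOf_eq, h3, Set.mem_insert_iff, Set.mem_image, Set.mem_Iic]
      constructor
      · rintro ⟨i, hi, rfl⟩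
        rcases i with _ | i
        · exact Or.inl rfl
        · exact Or.inr ⟨i, by omega, (ws i).symm⟩
      · rintro (rfl | ⟨i, hi, rfl⟩)
        · exact ⟨0, by omega, rfl⟩
        · exact ⟨i + 1, by omega, (ws i).symm⟩
    · ext e
      rw [h4, Set.mem_singleton_iff]
      constructor
      · rintro ⟨i, j, hij, hj, hne, ha, rfl⟩
        obtain ⟨j, rfl⟩ : ∃ k, j = k + 1 := ⟨j - 1, by omega⟩
        rcases i with _ | i
        · rw [w0, ws] at ha
          exact absurd ha (hrmin j (by omega) (by omega))
        · rw [ws, ws] at ha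
          obtain ⟨rfl, rfl⟩ := honly i j ⟨by omega, by omega, ha⟩
          rw [ws, ws]
      · rintro rfl
        exact ⟨2, 4, by omega, by rcases ho with ⟨k, rfl⟩; omega, by omega, hchord, rfl⟩
  have B : Even r → 4 ≤ r ∧ ∃ (u : V) (c : G.Walk u u), c.IsCycle ∧ c.length = r + 1 ∧
        {x | x ∈ c.support} = insert z (insert (v 0) (insert (v 1) (v '' Set.Icc 3 r))) ∧
        G.cycleChords c = ∅ := by
    intro he
    have r4 : 4 ≤ r := by rcases he with ⟨k, rfl⟩; omega
    refine ⟨r4, ?_⟩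
    let f : ℕ → ℕ := fun i => if i < 3 then i - 1 else i
    let w : ℕ → V := fun i => if i = 0 then z else v (f i)
    have w0 : w 0 = z := rfl
    have ws : ∀ i, i ≠ 0 → w i = v (f i) := fun i hi => by simp [w, hi]
    have fle : ∀ i, f i ≤ i := fun i => by simp only [f]; split_ifs <;> omega
    obtain ⟨u, c, h1, h2, h3, h4⟩ := aux_cycle G w r (by omega) (by
      intro i hi j hj h
      simp only [Set.mem_Iic] at hi hj
      have := fle i
      have := fle j
      by_cases hi0 : i = 0 <;> by_cases hj0 : j = 0
      · omega
      · rw [hi0, w0, ws _ hj0] at h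
        exact absurd h (hz _ (by omega))
      · rw [hj0, w0, ws _ hi0] at h
        exact absurd h.symm (hz _ (by omega))
      · rw [ws _ hi0, ws _ hj0] at h
        have := inj _ _ (by omega) (by omega) h
        simp only [f] at this
        split_ifs at this <;> omega) (by
      intro i hi
      by_cases hi0 : i = 0
      · subst hi0; exact hz0
      by_cases hi1 : i = 1
      · subst hi1; exact hpath 0 (by omega)
      by_cases hi2 : i = 2
      · subst hi2; exact hchord
      · have e1 : f i = i := by simp only [f]; split_ifs <;> omega
        have e2 : f (i + 1) = i + 1 := by simp only [f]; split_ifs <;> omega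
        rw [ws _ hi0, ws _ (by omega), e1, e2]
        exact hpath i (by omega)) (by
      have e1 : f r = r := by simp only [f]; split_ifs <;> omega
      rw [ws _ (by omega), e1]; exact hzr.symm)
    refine ⟨u, c, h1, h2, ?_, ?_⟩
    · ext x
      simp only [Set.mem_setOf_eq, h3, Set.mem_insert_iff, Set.mem_image, Set.mem_Icc]
      constructor
      · rintro ⟨i, hi, rfl⟩
        by_cases hi0 : i = 0
        · subst hi0; exact Or.inl rfl
        by_cases hi1 : i = 1
        · subst hi1; exact Or.inr (Or.inl rfl)
        by_cases hi2 : i = 2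
        · subst hi2; exact Or.inr (Or.inr (Or.inl rfl))
        · have e1 : f i = i := by simp only [f]; split_ifs <;> omega
          exact Or.inr (Or.inr (Or.inr ⟨i, by omega, by rw [ws _ hi0, e1]⟩))
      · rintro (rfl | rfl | rfl | ⟨i, hi, rfl⟩)
        · exact ⟨0, by omega, rfl⟩
        · exact ⟨1, by omega, rfl⟩
        · exact ⟨2, by omega, rfl⟩
        · have e1 : f i = i := by simp only [f]; split_ifs <;> omega
          exact ⟨i, by omega, by rw [ws _ (by omega), e1]⟩
    · ext e
      rw [h4]
      simp only [Set.mem_empty_iff_false, iff_false]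
      rintro ⟨i, j, hij, hj, hne, ha, rfl⟩
      have := fle j
      by_cases hi0 : i = 0
      · rw [hi0, w0, ws _ (by omega)] at ha
        refine hrmin (f j) ?_ ?_ ha
        · simp only [f]; split_ifs <;> omega
        · omega
      · rw [ws _ hi0, ws _ (by omega)] at ha
        have := honly (f i) (f j) ⟨by simp only [f]; split_ifs <;> omega, by omega, ha⟩
        simp only [f] at this
        split_ifs at this <;> omega
  refine ⟨⟨fun ho => ?_, fun he => ?_⟩, ?_⟩
  · obtain ⟨u, c, h1, h2, h3, h4⟩ := A ho
    exact ⟨u, c, h1, by rw [h2]; exact ho.add_even (by decide), h3, h4⟩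
  · obtain ⟨r4, u, c, h1, h2, h3, h4⟩ := B he
    exact ⟨r4, u, c, h1, by rw [h2]; exact he.add_one, by omega, h3, h4⟩
  · rcases Nat.even_or_odd r with he | ho
    · obtain ⟨r4, u, c, h1, h2, h3, h4⟩ := B he
      exact ⟨u, c, h1, by rw [h2]; exact he.add_one, by omega, by simp [h4]⟩
    · obtain ⟨u, c, h1, h2, h3, h4⟩ := A ho
      exact ⟨u, c, h1, by rw [h2]; exact ho.add_even (by decide), by omega, by simp [h4]⟩
end
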